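/- arXiv:1808.02955 — 3 statements merged into one kernel-verified Lean document; each statement's English description precedes it below -/
import Mathlib

section
/- Fix integers n ≥ 2 and 1 ≤ k ≤ n−1, and let Λ(k,n) = { n·(ζ₁+…+ζ_k) : {ζ₁,…,ζ_k} is a root set of type (k,n) } ⊂ ℂ. Consider the group O(2) of ℝ-linear isometries of ℂ ≅ ℝ² (for the Euclidean metric). The subgroup of O(2) consisting of all elements that map the set Λ(k,n) onto itself is exactly the subgroup generated by the rotation z ↦ e^{2πi/n}z and complex conjugation z ↦ conj(z); in particular it is isomorphic to the dihedral group D_n of order 2n. -/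
/-- A root set of type `(k,n)`: a set of `k` distinct complex numbers
each satisfying `ζ^n = (-1)^(k+1)`. -/
def IsRootSet (k n : ℕ) (I : Finset ℂ) : Prop :=
  I.card = k ∧ ∀ z ∈ I, z ^ n = (-1 : ℂ) ^ (k + 1)

/-- `Λ(k,n) = { n·(ζ₁+…+ζ_k) : {ζ₁,…,ζ_k} a root set of type (k,n) }`,
the set of eigenvalues of `c₁⋆` on `QH(Gr(k,n))`. -/
def lambdaSet (k n : ℕ) : Set ℂ :=
  {z : ℂ | ∃ I : Finset ℂ, IsRootSet k n I ∧ z = n * ∑ x ∈ I, x}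

/-- Rotation of `ℂ ≅ ℝ²` by the angle `2π/n`, as a linear isometry. -/
noncomputable def rotLIE (n : ℕ) : ℂ ≃ₗᵢ[ℝ] ℂ := rotation (Circle.exp (2 * Real.pi / n))

open Complex in
lemma lam_key (n k : ℕ) (hn : 2 ≤ n) (hk1 : 1 ≤ k) (I : Finset ℂ) (hI : IsRootSet k n I)
    (η₀ : ℂ) (hη₀ : η₀ ∉ I) (hη₀' : η₀ ^ n = (-1 : ℂ) ^ (k + 1))
    (u : ℂ) (hu : ‖u‖ = 1) (r : ℝ) (hr : r ≠ 0) (hS : ∑ x ∈ I, x = r * u)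
    (hsep : ∀ ζ ∈ I, ∀ η ∉ I, η ^ n = (-1 : ℂ) ^ (k + 1) →
      (η * (starRingEnd ℂ) u).re < (ζ * (starRingEnd ℂ) u).re) : u ^ n = 1 := by
  have hn0 : n ≠ 0 := by omega
  have hnR : (0 : ℝ) < n := by positivity
  have hnC : (n : ℂ) ≠ 0 := by exact_mod_cast hn0
  have hpi := Real.pi_pos
  have hu0 : u ≠ 0 := by intro h; simp [h] at hu
  have huu : (starRingEnd ℂ) u * u = 1 := by
    rw [mul_comm, Complex.mul_conj, Complex.normSq_eq_norm_sq, hu]; simp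
  have hnorm : ∀ z : ℂ, z ^ n = (-1 : ℂ) ^ (k + 1) → ‖z * (starRingEnd ℂ) u‖ = 1 := by
    intro z hz
    have h1 : ‖z‖ ^ n = 1 := by rw [← norm_pow, hz]; simp
    have h2 : ‖z‖ = 1 := (pow_eq_one_iff_of_nonneg (norm_nonneg _) hn0).1 h1
    rw [norm_mul, h2, RCLike.norm_conj, hu, one_mul]
  set A : ℂ → ℝ := fun z => arg (z * (starRingEnd ℂ) u) with hA
  have hexp : ∀ z : ℂ, z ^ n = (-1 : ℂ) ^ (k + 1) → z = u * exp (A z * Complex.I) := by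
    intro z hz
    have := norm_mul_exp_arg_mul_I (z * (starRingEnd ℂ) u)
    rw [hnorm z hz] at this
    simp only [hA]
    simp only [ofReal_one, one_mul] at this
    rw [this]
    linear_combination (-z) * huu
  have hAu : ∀ t : ℝ, |t| < Real.pi → A (u * exp (t * Complex.I)) = t := by
    intro t ht
    simp only [hA]
    have : u * exp (t * Complex.I) * (starRingEnd ℂ) u = exp (t * Complex.I) := by
      linear_combination exp (t * Complex.I) * huu
    rw [this, arg_exp_mul_I, toIocMod_eq_self]
    rw [abs_lt] at ht
    constructor <;> linarith
  have hre : ∀ z : ℂ, z ^ n = (-1 : ℂ) ^ (k + 1) →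
      (z * (starRingEnd ℂ) u).re = Real.cos |A z| := by
    intro z hz
    have := norm_mul_cos_arg (z * (starRingEnd ℂ) u)
    rw [hnorm z hz, one_mul] at this
    rw [Real.cos_abs, ← this]
  have hApi : ∀ z, |A z| ≤ Real.pi := fun z => abs_arg_le_pi _
  have hlt : ∀ ζ ∈ I, ∀ η ∉ I, η ^ n = (-1 : ℂ) ^ (k + 1) → |A ζ| < |A η| := by
    intro ζ hζ η hη hη'
    have h := hsep ζ hζ η hη hη'
    rw [hre η hη', hre ζ (hI.2 ζ hζ)] at h
    by_contra hc
    push Not at hc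
    exact absurd (Real.cos_le_cos_of_nonneg_of_le_pi (abs_nonneg _) (hApi ζ) hc) (not_le.2 h)
  have hne : I.Nonempty := by
    rw [← Finset.card_pos, hI.1]; omega
  obtain ⟨ζm, hζm, hmax⟩ := I.exists_max_image (fun z => |A z|) hne
  set γ := |A ζm| with hγ
  have hγpi : γ < Real.pi := lt_of_lt_of_le (hlt ζm hζm η₀ hη₀ hη₀') (hApi _)
  set δ := A ζm with hδ
  set θ : ℤ → ℝ := fun j => δ + 2 * Real.pi * j / n with hθ
  set p : ℤ → ℂ := fun j => u * exp (θ j * Complex.I) with hp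
  have hpn : ∀ j, p j ^ n = u ^ n * exp ((n * θ j : ℝ) * Complex.I) := by
    intro j
    simp only [hp, mul_pow, ← Complex.exp_nat_mul]
    push_cast
    ring_nf
  have hnθ : ∀ j, n * θ j = n * δ + 2 * Real.pi * j := by
    intro j; simp only [hθ]; field_simp
  have hproot : ∀ j, p j ^ n = (-1 : ℂ) ^ (k + 1) := by
    intro j
    have h0 := hI.2 ζm hζm
    rw [hexp ζm (hI.2 ζm hζm), mul_pow, ← Complex.exp_nat_mul] at h0
    rw [hpn, hnθ, ← h0]
    congr 1
    rw [Complex.exp_eq_exp_iff_exists_int]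
    exact ⟨j, by push_cast; ring⟩
  set a : ℤ := ⌈(-γ - δ) * n / (2 * Real.pi)⌉ with ha
  set b : ℤ := ⌊(γ - δ) * n / (2 * Real.pi)⌋ with hb
  have hmem : ∀ j, j ∈ Finset.Icc a b ↔ |θ j| ≤ γ := by
    intro j
    rw [Finset.mem_Icc, ha, hb, Int.ceil_le, Int.le_floor, abs_le, div_le_iff₀ (by positivity),
      le_div_iff₀ (by positivity)]
    simp only [hθ]
    have e : δ + 2 * Real.pi * j / n = (δ * n + j * (2 * Real.pi)) / n := by field_simp
    rw [e, le_div_iff₀ hnR, div_le_iff₀ hnR]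
    constructor <;> rintro ⟨h1, h2⟩ <;> constructor <;> linarith
  have hpA : ∀ j ∈ Finset.Icc a b, A (p j) = θ j := by
    intro j hj
    exact hAu _ (lt_of_le_of_lt ((hmem j).1 hj) hγpi)
  have hinj : Set.InjOn p (Finset.Icc a b : Finset ℤ) := by
    intro i hi j hj hij
    have h : θ i = θ j := by rw [← hpA i hi, ← hpA j hj, hij]
    simp only [hθ] at h
    have h2 : (i : ℝ) = j := by
      field_simp at h
      have h3 : 2 * Real.pi * (i : ℝ) = 2 * Real.pi * j := by linarith
      exact mul_left_cancel₀ (by positivity) h3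
    exact_mod_cast h2
  have hImg : I = (Finset.Icc a b).image p := by
    ext z
    rw [Finset.mem_image]
    constructor
    · intro hz
      have hz' := hI.2 z hz
      have h1 := hz'
      rw [hexp z hz', ← hI.2 ζm hζm] at h1
      nth_rewrite 1 [hexp ζm (hI.2 ζm hζm)] at h1
      rw [mul_pow, mul_pow, ← Complex.exp_nat_mul, ← Complex.exp_nat_mul] at h1
      have h2 := mul_left_cancel₀ (pow_ne_zero n hu0) h1
      rw [Complex.exp_eq_exp_iff_exists_int] at h2
      obtain ⟨j, hj⟩ := h2
      have h3 : (n : ℂ) * A z = n * δ + j * (2 * Real.pi) := by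
        apply mul_right_cancel₀ Complex.I_ne_zero
        linear_combination hj
      have h4 : (n : ℝ) * A z = n * δ + j * (2 * Real.pi) := by exact_mod_cast h3
      have h5 : θ j = A z := by
        simp only [hθ]; field_simp; linarith
      refine ⟨j, (hmem j).2 ?_, ?_⟩
      · rw [h5]; exact hmax z hz
      · simp only [hp]; rw [h5]; exact (hexp z hz').symm
    · rintro ⟨j, hj, rfl⟩
      by_contra hc
      have := hlt ζm hζm _ hc (hproot j)
      rw [hpA j hj] at this
      exact absurd ((hmem j).1 hj) (not_le.2 this)
  have hcard : (b + 1 - a).toNat = k := by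
    rw [← hI.1, hImg, Finset.card_image_of_injOn hinj, Int.card_Icc]
  have hT : ∑ j ∈ Finset.Icc a b, exp (θ j * Complex.I) = r := by
    rw [hImg, Finset.sum_image hinj, ← Finset.mul_sum, mul_comm] at hS
    exact mul_right_cancel₀ hu0 hS
  have hab : a ≤ b := by omega
  have hrefl : (r : ℂ) * exp ((θ a + θ b : ℝ) * Complex.I) = r := by
    have h1 : (r : ℂ) = ∑ j ∈ Finset.Icc a b, exp (-(θ j * Complex.I)) := by
      have := congrArg (starRingEnd ℂ) hT
      rw [map_sum, Complex.conj_ofReal] at this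
      rw [← this]
      apply Finset.sum_congr rfl
      intro j _
      rw [← Complex.exp_conj, map_mul, Complex.conj_ofReal, Complex.conj_I]
      ring_nf
    nth_rewrite 1 [h1]
    rw [← hT, Finset.sum_mul]
    refine Finset.sum_bij' (fun j _ => a + b - j) (fun j _ => a + b - j) ?_ ?_ ?_ ?_ ?_
    · intro j hj; rw [Finset.mem_Icc] at *; omega
    · intro j hj; rw [Finset.mem_Icc] at *; omega
    · intro j _; ring
    · intro j _; ring
    · intro j _
      rw [← Complex.exp_add]
      congr 1
      simp only [hθ]
      push_cast
      ring
  have hone : exp ((θ a + θ b : ℝ) * Complex.I) = 1 := by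
    have hrC : (r : ℂ) ≠ 0 := by exact_mod_cast hr
    exact mul_left_cancel₀ hrC (by rw [hrefl, mul_one])
  have hzero : θ a + θ b = 0 := by
    rw [Complex.exp_eq_one_iff] at hone
    obtain ⟨m, hm⟩ := hone
    have h3 : ((θ a + θ b : ℝ) : ℂ) = m * (2 * Real.pi) := by
      apply mul_right_cancel₀ Complex.I_ne_zero
      linear_combination hm
    have h4 : θ a + θ b = m * (2 * Real.pi) := by exact_mod_cast h3
    have h5 := (hmem a).1 (Finset.mem_Icc.2 ⟨le_rfl, hab⟩)
    have h6 := (hmem b).1 (Finset.mem_Icc.2 ⟨hab, le_rfl⟩)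
    rw [abs_le] at h5 h6
    have h7 : (m : ℝ) < 1 := by
      by_contra hc; push Not at hc; nlinarith
    have h8 : (-1 : ℝ) < m := by
      by_contra hc; push Not at hc; nlinarith
    have h9 : m = 0 := by
      have : m < 1 := by exact_mod_cast h7
      have : -1 < m := by exact_mod_cast h8
      omega
    rw [h4, h9]; simp
  obtain ⟨m, rfl⟩ : ∃ m, k = m + 1 := ⟨k - 1, by omega⟩
  have hbm : b = a + m := by omega
  have hval : n * θ a = -(m * Real.pi) := by
    have h1 := hnθ a
    have h2 := hnθ b
    have h3 : n * θ a + n * θ b = 0 := by rw [← mul_add, hzero, mul_zero]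
    have h4 : (b : ℝ) = a + m := by exact_mod_cast hbm
    rw [h4] at h2
    linarith
  have hfin := hproot a
  rw [hpn, hval] at hfin
  have hE : exp ((-(m * Real.pi) : ℝ) * Complex.I) = (-1) ^ m := by
    have : ((-(m * Real.pi) : ℝ) : ℂ) * Complex.I = -(m * (Real.pi * Complex.I)) := by
      push_cast; ring
    rw [this, Complex.exp_neg, Complex.exp_nat_mul, Complex.exp_pi_mul_I, ← inv_pow]
    norm_num
  rw [hE] at hfin
  have hm0 : ((-1 : ℂ)) ^ m ≠ 0 := pow_ne_zero _ (by norm_num)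
  apply mul_right_cancel₀ hm0
  rw [hfin, pow_add, pow_add]; norm_num

lemma lam_roots (n k : ℕ) (hn : 2 ≤ n) : ∃ R : Finset ℂ, R.card = n ∧
    ∀ z, z ∈ R ↔ z ^ n = (-1 : ℂ) ^ (k + 1) := by
  have hn0 : n ≠ 0 := by omega
  have hp := Complex.isPrimitiveRoot_exp n hn0
  refine ⟨(Polynomial.nthRoots n ((-1 : ℂ) ^ (k + 1))).toFinset, ?_, ?_⟩
  · rw [Multiset.toFinset_card_of_nodup
      (hp.nthRoots_nodup (pow_ne_zero _ (by norm_num))), hp.card_nthRoots, if_pos]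
    exact IsAlgClosed.exists_pow_nat_eq _ (by omega)
  · intro z
    rw [Multiset.mem_toFinset, Polynomial.mem_nthRoots (by omega)]

lemma lam_max (n k : ℕ) (hn : 2 ≤ n) (hk1 : 1 ≤ k) (hk2 : k ≤ n - 1) (I : Finset ℂ)
    (hI : IsRootSet k n I)
    (hmax : ∀ J, IsRootSet k n J → ‖∑ x ∈ J, x‖ ≤ ‖∑ x ∈ I, x‖) :
    ∑ x ∈ I, x ≠ 0 ∧ ∃ u : ℂ, u ^ n = 1 ∧ ∑ x ∈ I, x = ‖∑ x ∈ I, x‖ * u := by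
  obtain ⟨R, hRc, hR⟩ := lam_roots n k hn
  set S := ∑ x ∈ I, x with hS
  have hex : ∃ η, η ∉ I ∧ η ^ n = (-1 : ℂ) ^ (k + 1) := by
    have : I.card < R.card := by rw [hI.1, hRc]; omega
    obtain ⟨η, h1, h2⟩ := Finset.exists_mem_notMem_of_card_lt_card this
    exact ⟨η, h2, (hR η).1 h1⟩
  have hsep : ∀ ζ ∈ I, ∀ η ∉ I, η ^ n = (-1 : ℂ) ^ (k + 1) →
      (η * (starRingEnd ℂ) S).re < (ζ * (starRingEnd ℂ) S).re := by
    intro ζ hζ η hη hη'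
    have hη2 : η ∉ I.erase ζ := fun h => hη (Finset.mem_of_mem_erase h)
    have hJ : IsRootSet k n (insert η (I.erase ζ)) := by
      constructor
      · rw [Finset.card_insert_of_notMem hη2, Finset.card_erase_of_mem hζ, hI.1]; omega
      · intro z hz
        rcases Finset.mem_insert.1 hz with rfl | hz
        · exact hη'
        · exact hI.2 z (Finset.mem_of_mem_erase hz)
    have h1 := hmax _ hJ
    have h2 : ∑ x ∈ insert η (I.erase ζ), x = S + (η - ζ) := by
      rw [Finset.sum_insert hη2, hS, ← Finset.add_sum_erase I (fun x => x) hζ]; ring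
    rw [h2] at h1
    have h3 : ‖S + (η - ζ)‖ ^ 2 ≤ ‖S‖ ^ 2 := by gcongr
    have hne : η - ζ ≠ 0 := by
      intro h; rw [sub_eq_zero] at h; exact hη (h ▸ hζ)
    have h4 := Complex.normSq_pos.2 hne
    rw [← Complex.normSq_eq_norm_sq, ← Complex.normSq_eq_norm_sq] at h3
    simp only [Complex.normSq_apply, Complex.add_re, Complex.add_im, Complex.sub_re,
      Complex.sub_im] at h3 h4
    simp only [Complex.mul_re, Complex.conj_re, Complex.conj_im]
    nlinarith
  obtain ⟨η, hη, hη'⟩ := hex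
  have hne : I.Nonempty := by rw [← Finset.card_pos, hI.1]; omega
  obtain ⟨ζ, hζ⟩ := hne
  have hS0 : S ≠ 0 := by
    intro h
    have := hsep ζ hζ η hη hη'
    simp [h] at this
  have hSn : 0 < ‖S‖ := norm_pos_iff.2 hS0
  have hSC : (‖S‖ : ℂ) ≠ 0 := by exact_mod_cast hSn.ne'
  have hSu : S = ‖S‖ * (S / ‖S‖) := by field_simp
  refine ⟨hS0, S / ‖S‖, ?_, hSu⟩
  refine lam_key n k hn hk1 I hI η hη hη' (S / ‖S‖) ?_ ‖S‖ hSn.ne' hSu ?_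
  · rw [norm_div, Complex.norm_real, norm_norm, div_self hSn.ne']
  · intro z hz w hw hw'
    have := hsep z hz w hw hw'
    rw [map_div₀, Complex.conj_ofReal, ← mul_div_assoc, ← mul_div_assoc, Complex.div_ofReal_re,
      Complex.div_ofReal_re]
    gcongr

lemma lam_map (n k : ℕ) (f : ℂ →+ ℂ) (hf : Function.Injective f)
    (hf' : ∀ z : ℂ, z ^ n = (-1 : ℂ) ^ (k + 1) → f z ^ n = (-1 : ℂ) ^ (k + 1))
    (z : ℂ) (hz : z ∈ lambdaSet k n) : f z ∈ lambdaSet k n := by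
  obtain ⟨I, hI, rfl⟩ := hz
  refine ⟨I.image f, ⟨?_, ?_⟩, ?_⟩
  · rw [Finset.card_image_of_injective _ hf, hI.1]
  · intro w hw
    obtain ⟨v, hv, rfl⟩ := Finset.mem_image.1 hw
    exact hf' v (hI.2 v hv)
  · rw [Finset.sum_image hf.injOn, ← map_sum, ← nsmul_eq_mul, map_nsmul, nsmul_eq_mul]

lemma lam_rot (n k : ℕ) (a : ℂ) (ha0 : a ≠ 0) (ha : a ^ n = 1)
    (z : ℂ) (hz : z ∈ lambdaSet k n) : a * z ∈ lambdaSet k n := by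
  refine lam_map n k (AddMonoidHom.mulLeft a) (mul_right_injective₀ ha0) ?_ z hz
  intro z hz
  simp [mul_pow, ha, hz]

lemma lam_conj (n k : ℕ) (z : ℂ) (hz : z ∈ lambdaSet k n) :
    (starRingEnd ℂ) z ∈ lambdaSet k n := by
  refine lam_map n k (starRingEnd ℂ).toAddMonoidHom (star_injective) ?_ z hz
  intro z hz
  show (starRingEnd ℂ) z ^ n = _
  rw [← map_pow, hz]
  simp

/-- The explicit embedding of the dihedral group into `O(2)`. -/
noncomputable def lamHom (n : ℕ) [NeZero n] : DihedralGroup n →* (ℂ ≃ₗᵢ[ℝ] ℂ) where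
  toFun
    | .r i => rotation (ZMod.toCircle i)
    | .sr i => Complex.conjLIE * rotation (ZMod.toCircle i)
  map_one' := by
    show rotation (ZMod.toCircle 0) = 1
    simp
  map_mul' := by
    rintro (i | i) (j | j)
    · show rotation (ZMod.toCircle (i + j)) = _
      rw [AddChar.map_add_eq_mul, map_mul]
    · show Complex.conjLIE * rotation (ZMod.toCircle (j - i)) = _
      ext z
      show (starRingEnd ℂ) (((ZMod.toCircle (j - i) : Circle) : ℂ) * z) =
        ((ZMod.toCircle i : Circle) : ℂ) * (starRingEnd ℂ) (((ZMod.toCircle j : Circle) : ℂ) * z)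
      rw [AddChar.map_sub_eq_div, div_eq_mul_inv, Circle.coe_mul, Circle.coe_inv_eq_conj]
      simp only [map_mul, Complex.conj_conj]
      ring
    · show Complex.conjLIE * rotation (ZMod.toCircle (i + j)) = _
      ext z
      simp [AddChar.map_add_eq_mul]
    · show rotation (ZMod.toCircle (j - i)) = _
      ext z
      show ((ZMod.toCircle (j - i) : Circle) : ℂ) * z =
        (starRingEnd ℂ) (((ZMod.toCircle i : Circle) : ℂ) * (starRingEnd ℂ) (((ZMod.toCircle j : Circle) : ℂ) * z))
      rw [AddChar.map_sub_eq_div, div_eq_mul_inv, Circle.coe_mul, Circle.coe_inv_eq_conj]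
      simp only [map_mul, Complex.conj_conj]
      ring

lemma lamHom_r (n : ℕ) [NeZero n] (i : ZMod n) :
    lamHom n (.r i) = rotation (ZMod.toCircle i) := rfl

lemma lamHom_sr (n : ℕ) [NeZero n] (i : ZMod n) :
    lamHom n (.sr i) = Complex.conjLIE * rotation (ZMod.toCircle i) := rfl

lemma lamHom_inj (n : ℕ) [NeZero n] : Function.Injective (lamHom n) := by
  rw [injective_iff_map_eq_one]
  rintro (i | i) h
  · rw [lamHom_r] at h
    have h1 : ZMod.toCircle i = ZMod.toCircle (0 : ZMod n) := by
      apply rotation_injective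
      rw [h]; simp
    rw [ZMod.injective_toCircle h1]; rfl
  · rw [lamHom_sr] at h
    exfalso
    apply rotation_ne_conjLIE (ZMod.toCircle i)⁻¹
    rw [map_inv, eq_comm]
    exact eq_inv_of_mul_eq_one_left h

lemma rotLIE_eq (n : ℕ) [NeZero n] : rotLIE n = lamHom n (.r 1) := by
  rw [lamHom_r, rotLIE]
  congr 1
  ext
  have := ZMod.toCircle_intCast (N := n) 1
  rw [Int.cast_one] at this
  rw [this, Circle.coe_exp]
  push_cast
  ring_nf

lemma lamHom_range (n : ℕ) [NeZero n] : (lamHom n).range =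
    Subgroup.closure ({rotLIE n, Complex.conjLIE} : Set (ℂ ≃ₗᵢ[ℝ] ℂ)) := by
  apply le_antisymm
  · have hr : ∀ i, lamHom n (.r i) ∈
        Subgroup.closure ({rotLIE n, Complex.conjLIE} : Set (ℂ ≃ₗᵢ[ℝ] ℂ)) := by
      intro i
      have : (DihedralGroup.r i : DihedralGroup n) = .r 1 ^ i.val := by simp
      rw [this, map_pow, ← rotLIE_eq]
      exact pow_mem (Subgroup.subset_closure (by simp)) _
    rintro _ ⟨i | i, rfl⟩
    · exact hr i
    · rw [lamHom_sr, ← lamHom_r]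
      exact mul_mem (Subgroup.subset_closure (by simp)) (hr i)
  · rw [Subgroup.closure_le]
    rintro g (rfl | rfl)
    · exact ⟨.r 1, (rotLIE_eq n).symm⟩
    · exact ⟨.sr 0, by rw [lamHom_sr]; simp⟩

lemma lam_circle (n : ℕ) [NeZero n] (a : Circle) (ha : (a : ℂ) ^ n = 1) :
    ∃ i : ZMod n, ZMod.toCircle i = a := by
  have hp := Complex.isPrimitiveRoot_exp n (NeZero.ne n)
  obtain ⟨j, _, hj⟩ := hp.eq_pow_of_pow_eq_one ha
  refine ⟨((j : ℤ) : ZMod n), ?_⟩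
  ext
  rw [ZMod.toCircle_intCast, ← hj, ← Complex.exp_nat_mul]
  congr 1
  push_cast
  ring

lemma lam_toCircle_pow (n : ℕ) [NeZero n] (i : ZMod n) :
    ((ZMod.toCircle i : Circle) : ℂ) ^ n = 1 := by
  rw [← Circle.coe_pow, ← AddChar.map_nsmul_eq_pow]
  simp

lemma lamHom_maps (n k : ℕ) [NeZero n] (x : DihedralGroup n) (z : ℂ)
    (hz : z ∈ lambdaSet k n) : lamHom n x z ∈ lambdaSet k n := by
  have hr : ∀ i : ZMod n, rotation (ZMod.toCircle i) z ∈ lambdaSet k n := by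
    intro i
    rw [rotation_apply]
    exact lam_rot n k _ (Circle.coe_ne_zero _) (lam_toCircle_pow n i) z hz
  rcases x with i | i
  · exact hr i
  · exact lam_conj n k _ (hr i)

lemma lam_stab (n k : ℕ) [NeZero n] (hn : 2 ≤ n) (hk1 : 1 ≤ k) (hk2 : k ≤ n - 1)
    (g : ℂ ≃ₗᵢ[ℝ] ℂ) (hg : ⇑g '' lambdaSet k n = lambdaSet k n) : g ∈ (lamHom n).range := by
  have hn0 : n ≠ 0 := by omega
  have hnC : (n : ℂ) ≠ 0 := by exact_mod_cast hn0
  obtain ⟨R, hRc, hR⟩ := lam_roots n k hn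
  have hpne : (R.powersetCard k).Nonempty := by
    rw [Finset.powersetCard_nonempty, hRc]; omega
  have hrs : ∀ J, IsRootSet k n J ↔ J ∈ R.powersetCard k := by
    intro J
    rw [Finset.mem_powersetCard]
    constructor
    · intro h; exact ⟨fun z hz => (hR z).2 (h.2 z hz), h.1⟩
    · intro h; exact ⟨h.2, fun z hz => (hR z).1 (h.1 hz)⟩
  obtain ⟨I, hI, hmax⟩ := Finset.exists_max_image _ (fun J => ‖∑ x ∈ J, x‖) hpne
  have hI' := (hrs I).2 hI
  have hmax' : ∀ J, IsRootSet k n J → ‖∑ x ∈ J, x‖ ≤ ‖∑ x ∈ I, x‖ :=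
    fun J hJ => hmax J ((hrs J).1 hJ)
  obtain ⟨hS0, u, hun, hSu⟩ := lam_max n k hn hk1 hk2 I hI' hmax'
  set M := ‖∑ x ∈ I, x‖ with hM
  have hM0 : (M : ℂ) ≠ 0 := by
    rw [hM]; exact_mod_cast norm_ne_zero_iff.2 hS0
  have hu0 : u ≠ 0 := by rintro rfl; simp [hn0] at hun
  have hmem : ((n * M : ℝ) : ℂ) ∈ lambdaSet k n := by
    have h1 : (n : ℂ) * ∑ x ∈ I, x ∈ lambdaSet k n := ⟨I, hI', rfl⟩
    have h2 := lam_rot n k u⁻¹ (inv_ne_zero hu0) (by rw [inv_pow, hun, inv_one]) _ h1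
    have h3 : ((n * M : ℝ) : ℂ) = u⁻¹ * (n * ∑ x ∈ I, x) := by
      rw [hSu]; push_cast; field_simp
    rw [h3]; exact h2
  have hgm : g ((n * M : ℝ) : ℂ) ∈ lambdaSet k n := by
    rw [← hg]; exact ⟨_, hmem, rfl⟩
  have main : ∀ a : Circle, g ((n * M : ℝ) : ℂ) = a * ((n * M : ℝ) : ℂ) →
      ∃ i : ZMod n, ZMod.toCircle i = a := by
    intro a ha
    apply lam_circle
    obtain ⟨J, hJ, hJe⟩ := hgm
    rw [ha] at hJe
    have hJs : ∑ x ∈ J, x = a * M := by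
      apply mul_left_cancel₀ hnC
      rw [← hJe]; push_cast; ring
    have hJn : ‖∑ x ∈ J, x‖ = M := by
      rw [hJs, norm_mul, Circle.norm_coe, one_mul, Complex.norm_real, hM, norm_norm]
    obtain ⟨_, v, hv, hJv⟩ := lam_max n k hn hk1 hk2 J hJ
      (fun K hK => by rw [hJn]; exact hmax' K hK)
    rw [hJn, hJs, mul_comm] at hJv
    rw [mul_left_cancel₀ hM0 hJv, hv]
  obtain ⟨a, rfl | rfl⟩ := linear_isometry_complex g
  · obtain ⟨i, hi⟩ := main a (rotation_apply _ _)
    exact ⟨.r i, by rw [lamHom_r, hi]⟩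
  · obtain ⟨i, hi⟩ := main a (by
      rw [LinearIsometryEquiv.trans_apply, rotation_apply, Complex.conjLIE_apply,
        Complex.conj_ofReal])
    refine ⟨.r i * .sr 0, ?_⟩
    rw [map_mul, lamHom_r, lamHom_sr, hi]
    ext z
    simp

/-- Inside the group `O(2)` of `ℝ`-linear isometries of `ℂ`, the subgroup of elements
mapping `Λ(k,n)` onto itself is exactly the subgroup generated by the rotation
`z ↦ e^{2πi/n}·z` and complex conjugation; in particular it is isomorphic to the
dihedral group `D_n` of order `2n`. -/
theorem lambdaSet_stabilizer_eq_dihedral (n k : ℕ) (hn : 2 ≤ n)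
    (hk1 : 1 ≤ k) (hk2 : k ≤ n - 1) :
    {g : ℂ ≃ₗᵢ[ℝ] ℂ | ⇑g '' lambdaSet k n = lambdaSet k n} =
      ↑(Subgroup.closure ({rotLIE n, Complex.conjLIE} : Set (ℂ ≃ₗᵢ[ℝ] ℂ))) ∧
    Nonempty
      ((Subgroup.closure ({rotLIE n, Complex.conjLIE} : Set (ℂ ≃ₗᵢ[ℝ] ℂ))) ≃*
        DihedralGroup n) := by
  have : NeZero n := ⟨by omega⟩
  rw [← lamHom_range]
  refine ⟨?_, ⟨(MonoidHom.ofInjective (lamHom_inj n)).symm⟩⟩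
  ext g
  constructor
  · exact fun hg => lam_stab n k hn hk1 hk2 g hg
  · rintro ⟨x, rfl⟩
    apply Set.Subset.antisymm
    · rintro _ ⟨z, hz, rfl⟩
      exact lamHom_maps n k x z hz
    · intro z hz
      refine ⟨_, lamHom_maps n k x⁻¹ z hz, ?_⟩
      show (lamHom n x * lamHom n x⁻¹) z = z
      rw [← map_mul, mul_inv_cancel, map_one]
      rfl
end

section
/- Fix integers n ≥ 2 and 1 ≤ k ≤ n−1, and let I be a root set of type (k,n). Write S_λ(I) for the evaluation at I of the k-variable Schur polynomial of the partition λ. Then the following identities hold: (i) for each 1 ≤ a ≤ k−1, S_{((n−k)^a, 1)}(I) = S_{(1)}(I) · S_{((n−k)^a)}(I), where ((n−k)^a,1) is the partition with a parts equal to n−k followed by one part equal to 1; (ii) for each 1 ≤ b ≤ n−k−1, S_{(b+1, b^{k−1})}(I) = S_{(1)}(I) · S_{(b^k)}(I), where (b+1, b^{k−1}) is the partition with one part b+1 followed by k−1 parts equal to b; (iii) S_{((n−k−1)^{k−1})}(I) = S_{(1)}(I) · S_{((n−k)^k)}(I). Here S_{(1)}(I) = Σ_{ζ∈I} ζ. (These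 identities express that the quantum Pieri product of the Schubert class of a single box with each boundary rectangular Schubert class of Gr(k,n), which is a single Schubert class, is diagonalized on the Schur basis with eigenvalues given by Schur evaluations at root sets.) -/
noncomputable section

/-- Cells of the Young diagram of `lam` (at most `m` rows). -/
def youngCells (m : ℕ) (lam : ℕ → ℕ) : Finset (ℕ × ℕ) :=
  (Finset.range m).biUnion fun r => (Finset.range (lam r)).image fun c => (r, c)

/-- A filling of the diagram with entries in `{1,…,m}` is a semistandard Young tableau if
rows are weakly increasing and columns are strictly increasing. -/
def IsSSYT {m : ℕ} {lam : ℕ → ℕ} (T : {p // p ∈ youngCells m lam} → Fin m) : Prop :=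
  (∀ p q : {p // p ∈ youngCells m lam},
      (p : ℕ × ℕ).1 = (q : ℕ × ℕ).1 → (q : ℕ × ℕ).2 = (p : ℕ × ℕ).2 + 1 → T p ≤ T q) ∧
  (∀ p q : {p // p ∈ youngCells m lam},
      (p : ℕ × ℕ).2 = (q : ℕ × ℕ).2 → (q : ℕ × ℕ).1 = (p : ℕ × ℕ).1 + 1 → T p < T q)

open Classical in
/-- The finite set of semistandard Young tableaux of shape `lam` with entries in `{1,…,m}`. -/
def ssytFinset (m : ℕ) (lam : ℕ → ℕ) : Finset ({p // p ∈ youngCells m lam} → Fin m) :=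
  Finset.univ.filter IsSSYT

/-- The Schur polynomial of the partition `lam`, evaluated at `x 0, …, x (m-1)`:
the sum over semistandard Young tableaux of the corresponding monomials. -/
def schur (m : ℕ) (lam : ℕ → ℕ) (x : Fin m → ℂ) : ℂ :=
  ∑ T ∈ ssytFinset m lam, ∏ p, x (T p)

/-- Evaluation of the Schur polynomial (in `I.card` variables) at a finite set of
complex numbers; well defined since Schur polynomials are symmetric. -/
def schurSet (lam : ℕ → ℕ) (I : Finset ℂ) : ℂ :=
  schur I.card lam fun i => (I.equivFin.symm i : ℂ)

/-- The rectangular partition `(partSize^numParts)`: `numParts` parts equal to `partSize`. -/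
def rectPart (numParts partSize : ℕ) : ℕ → ℕ := fun r => if r < numParts then partSize else 0


lemma mem_youngCells {m : ℕ} {lam : ℕ → ℕ} {p : ℕ × ℕ} :
    p ∈ youngCells m lam ↔ p.1 < m ∧ p.2 < lam p.1 := by
  obtain ⟨r, c⟩ := p
  simp only [youngCells, Finset.mem_biUnion, Finset.mem_range, Finset.mem_image, Prod.mk.injEq]
  constructor
  · rintro ⟨a, ha, b, hb, rfl, rfl⟩
    exact ⟨ha, hb⟩
  · rintro ⟨h1, h2⟩
    exact ⟨r, h1, c, h2, rfl, rfl⟩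

lemma card_youngCells (m : ℕ) (lam : ℕ → ℕ) :
    (youngCells m lam).card = ∑ r ∈ Finset.range m, lam r := by
  unfold youngCells
  rw [Finset.card_biUnion]
  · refine Finset.sum_congr rfl fun r _ => ?_
    rw [Finset.card_image_of_injective, Finset.card_range]
    intro a b h
    simpa using h
  · intro a _ b _ hab
    refine Finset.disjoint_left.2 ?_
    intro p hp hq
    simp only [Finset.mem_image] at hp hq
    obtain ⟨_, _, rfl⟩ := hp
    obtain ⟨_, _, h⟩ := hq
    simp at h
    exact hab h.1.symm

/-- extension by zero of a finite sequence -/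
def extz (m : ℕ) (mu : Fin m → ℕ) : ℕ → ℕ := fun r => if h : r < m then mu ⟨r, h⟩ else 0

lemma extz_apply {m : ℕ} (mu : Fin m → ℕ) (j : Fin m) : extz m mu j = mu j := by
  simp [extz]

lemma extz_lt {m : ℕ} (mu : Fin m → ℕ) {r : ℕ} (h : r < m) : extz m mu r = mu ⟨r, h⟩ := by
  simp [extz, h]

lemma ssyt_row {m : ℕ} {lam : ℕ → ℕ} {T : {p // p ∈ youngCells m lam} → Fin m}
    (hT : IsSSYT T) (r c d : ℕ) (hc : (r, c) ∈ youngCells m lam)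
    (hd : (r, c + d) ∈ youngCells m lam) : T ⟨(r, c), hc⟩ ≤ T ⟨(r, c + d), hd⟩ := by
  induction d with
  | zero => exact le_rfl
  | succ d ih =>
    have h1 : (r, c + d) ∈ youngCells m lam := by
      rw [mem_youngCells] at hd ⊢
      simp only at hd ⊢
      omega
    exact (ih h1).trans (hT.1 ⟨(r, c + d), h1⟩ ⟨(r, c + (d + 1)), hd⟩ rfl rfl)

lemma ssyt_col {m : ℕ} {lam : ℕ → ℕ} (hlam : ∀ i, i + 1 < m → lam (i + 1) ≤ lam i)
    {T : {p // p ∈ youngCells m lam} → Fin m}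
    (hT : IsSSYT T) (r c : ℕ) (hc : (r, c) ∈ youngCells m lam) : r ≤ (T ⟨(r, c), hc⟩ : ℕ) := by
  induction r with
  | zero => exact Nat.zero_le _
  | succ r ih =>
    have h1 : (r, c) ∈ youngCells m lam := by
      rw [mem_youngCells] at hc ⊢
      simp only at hc ⊢
      have := hlam r hc.1
      omega
    have h2 := hT.2 ⟨(r, c), h1⟩ ⟨(r + 1, c), hc⟩ rfl rfl
    have h3 := ih h1
    have h4 : (T ⟨(r, c), h1⟩ : ℕ) < T ⟨(r + 1, c), hc⟩ := h2
    omega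

/-- glue a tableau with smaller entries and a strip of maximal entries -/
def glue (m : ℕ) (lam nu : ℕ → ℕ) (S : {p // p ∈ youngCells m nu} → Fin m) :
    {p // p ∈ youngCells (m + 1) lam} → Fin (m + 1) :=
  fun p => if h : (p : ℕ × ℕ) ∈ youngCells m nu then (S ⟨p, h⟩).castSucc else Fin.last m

lemma glue_ssyt {m : ℕ} {lam nu : ℕ → ℕ} (h1 : ∀ r, r < m → lam (r + 1) ≤ nu r)
    {S : {p // p ∈ youngCells m nu} → Fin m} (hS : IsSSYT S) : IsSSYT (glue m lam nu S) := by
  constructor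
  · rintro ⟨⟨r, c⟩, hp⟩ ⟨⟨r', c'⟩, hq⟩ h h'
    simp only at h h'
    subst h h'
    unfold glue
    by_cases hqn : (r, c + 1) ∈ youngCells m nu
    · have hpn : (r, c) ∈ youngCells m nu := by
        rw [mem_youngCells] at hqn ⊢
        simp only at hqn ⊢
        omega
      simp only [hqn, hpn, dif_pos]
      exact hS.1 ⟨(r, c), hpn⟩ ⟨(r, c + 1), hqn⟩ rfl rfl
    · simp only [hqn, dif_neg, not_false_eq_true]
      exact Fin.le_last _
  · rintro ⟨⟨r, c⟩, hp⟩ ⟨⟨r', c'⟩, hq⟩ h h'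
    simp only at h h'
    subst h h'
    unfold glue
    have hpn : (r, c) ∈ youngCells m nu := by
      rw [mem_youngCells] at hq ⊢
      simp only at hq ⊢
      have := h1 r (by omega)
      omega
    by_cases hqn : (r + 1, c) ∈ youngCells m nu
    · simp only [hqn, hpn, dif_pos]
      exact hS.2 ⟨(r, c), hpn⟩ ⟨(r + 1, c), hqn⟩ rfl rfl
    · simp only [hqn, hpn, dif_neg, not_false_eq_true, dif_pos]
      exact Fin.castSucc_lt_last _

lemma glue_prod {m : ℕ} {lam nu : ℕ → ℕ} (h2 : ∀ r, r < m → nu r ≤ lam r)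
    (S : {p // p ∈ youngCells m nu} → Fin m) (x : Fin (m + 1) → ℂ) :
    ∏ p, x (glue m lam nu S p) =
      x (Fin.last m) ^ (lam m + ∑ r ∈ Finset.range m, (lam r - nu r)) *
        ∏ p, x (S p).castSucc := by
  classical
  have hsub : youngCells m nu ⊆ youngCells (m + 1) lam := by
    intro p hp
    rw [mem_youngCells] at hp ⊢
    have := h2 p.1 hp.1
    omega
  let f : ℕ × ℕ → ℂ := fun p => if h : p ∈ youngCells m nu then x (S ⟨p, h⟩).castSucc
    else x (Fin.last m)
  have e1 : ∏ p, x (glue m lam nu S p) = ∏ p ∈ youngCells (m + 1) lam, f p := by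
    rw [← Finset.prod_coe_sort (youngCells (m + 1) lam) f]
    refine Finset.prod_congr rfl fun p _ => ?_
    simp only [glue, f]
    split_ifs <;> rfl
  have e2 : ∏ p, x (S p).castSucc = ∏ p ∈ youngCells m nu, f p := by
    rw [← Finset.prod_coe_sort (youngCells m nu) f]
    refine Finset.prod_congr rfl fun p _ => ?_
    simp only [f, p.2, dif_pos]
  have e3 : ∏ p ∈ youngCells (m + 1) lam \ youngCells m nu, f p =
      x (Fin.last m) ^ (lam m + ∑ r ∈ Finset.range m, (lam r - nu r)) := by
    have : ∀ p ∈ youngCells (m + 1) lam \ youngCells m nu, f p = x (Fin.last m) := by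
      intro p hp
      simp only [f, (Finset.mem_sdiff.1 hp).2, dif_neg, not_false_eq_true]
    rw [Finset.prod_congr rfl this, Finset.prod_const, Finset.card_sdiff_of_subset hsub,
      card_youngCells, card_youngCells, Finset.sum_range_succ]
    congr 1
    have : ∑ r ∈ Finset.range m, lam r =
        ∑ r ∈ Finset.range m, (lam r - nu r) + ∑ r ∈ Finset.range m, nu r := by
      rw [← Finset.sum_add_distrib]
      refine Finset.sum_congr rfl fun r hr => ?_
      have := h2 r (Finset.mem_range.1 hr)
      omega
    omega
  rw [e1, e2, ← e3, Finset.prod_sdiff hsub]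

lemma glue_surj {m : ℕ} {lam : ℕ → ℕ} (hlam : ∀ i, i + 1 < m + 1 → lam (i + 1) ≤ lam i)
    {T : {p // p ∈ youngCells (m + 1) lam} → Fin (m + 1)} (hT : IsSSYT T) :
    ∃ mu : Fin m → ℕ, (∀ j : Fin m, lam (j + 1) ≤ mu j ∧ mu j ≤ lam j) ∧
      ∃ S : {p // p ∈ youngCells m (extz m mu)} → Fin m, IsSSYT S ∧
        glue m lam (extz m mu) S = T := by
  classical
  have hex : ∀ r : ℕ, ∃ c : ℕ, ∀ h : (r, c) ∈ youngCells (m + 1) lam,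
      T ⟨(r, c), h⟩ = Fin.last m := fun r => ⟨lam r, fun h => by
    rw [mem_youngCells] at h
    simp at h⟩
  let mu : ℕ → ℕ := fun r => Nat.find (hex r)
  have hmu : ∀ r, ∀ h : (r, mu r) ∈ youngCells (m + 1) lam, T ⟨(r, mu r), h⟩ = Fin.last m :=
    fun r => Nat.find_spec (hex r)
  have hmul : ∀ r, mu r ≤ lam r := fun r => Nat.find_min' (hex r) fun h => by
    rw [mem_youngCells] at h
    simp at h
  have hmug : ∀ r, r < m → lam (r + 1) ≤ mu r := by
    intro r hr
    by_contra hlt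
    push Not at hlt
    have := hlam r (by omega)
    have c1 : (r, mu r) ∈ youngCells (m + 1) lam := by
      rw [mem_youngCells]; simp only; omega
    have c2 : (r + 1, mu r) ∈ youngCells (m + 1) lam := by
      rw [mem_youngCells]; simp only; omega
    have h3 := hT.2 ⟨_, c1⟩ ⟨_, c2⟩ rfl rfl
    rw [hmu r c1] at h3
    exact absurd (Fin.le_last _) (not_le.2 h3)
  have hmem : ∀ r c, ∀ h : (r, c) ∈ youngCells (m + 1) lam,
      (r, c) ∈ youngCells m (extz m fun j => mu j) ↔ T ⟨(r, c), h⟩ ≠ Fin.last m := by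
    intro r c h
    have h' := h
    rw [mem_youngCells] at h' ⊢
    simp only at h' ⊢
    constructor
    · rintro ⟨hr, hc⟩
      rw [extz_lt _ hr] at hc
      have := Nat.find_min (hex r) hc
      intro hh
      exact this fun _ => hh
    · intro hne
      have hr : r < m := by
        by_contra hr
        have h5 := ssyt_col hlam hT r c h
        apply hne
        apply Fin.ext
        simp only [Fin.val_last]
        have := (T ⟨(r, c), h⟩).2
        omega
      refine ⟨hr, ?_⟩
      rw [extz_lt _ hr]
      by_contra hc
      push Not at hc
      simp only at hc
      obtain ⟨d, rfl⟩ := Nat.exists_eq_add_of_le hc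
      have c1 : (r, mu r) ∈ youngCells (m + 1) lam := by
        rw [mem_youngCells]; simp only; omega
      have := ssyt_row hT r (mu r) d c1 h
      rw [hmu r c1] at this
      exact hne (le_antisymm (Fin.le_last _) this)
  have hsub : ∀ p, p ∈ youngCells m (extz m fun j => mu j) → p ∈ youngCells (m + 1) lam := by
    intro p hp
    rw [mem_youngCells] at hp ⊢
    have h0 := hp.2
    rw [extz_lt _ hp.1] at h0
    simp only at h0
    have := hmul p.1
    omega
  refine ⟨fun j => mu j, fun j => ⟨hmug j j.2, hmul j⟩,
    fun p => (T ⟨p, hsub p p.2⟩).castPred ((hmem p.1.1 p.1.2 (hsub p p.2)).1 p.2), ?_, ?_⟩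
  · constructor
    · intro p q h h'
      exact hT.1 ⟨p, hsub p p.2⟩ ⟨q, hsub q q.2⟩ h h'
    · intro p q h h'
      exact hT.2 ⟨p, hsub p p.2⟩ ⟨q, hsub q q.2⟩ h h'
  · funext p
    unfold glue
    split_ifs with h
    · simp
    · have := hmem p.1.1 p.1.2 p.2
      by_contra hne
      exact h (this.2 fun h' => hne h'.symm)

lemma glue_mem {m : ℕ} {lam nu : ℕ → ℕ} (S : {p // p ∈ youngCells m nu} → Fin m)
    (p : {p // p ∈ youngCells (m + 1) lam}) :
    (p : ℕ × ℕ) ∈ youngCells m nu ↔ glue m lam nu S p ≠ Fin.last m := by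
  unfold glue
  split_ifs with h
  · simp [h, Fin.castSucc_ne_last]
  · simp [h]

lemma glue_inj {m : ℕ} {lam nu : ℕ → ℕ} (h2 : ∀ r, r < m → nu r ≤ lam r)
    {S S' : {p // p ∈ youngCells m nu} → Fin m}
    (h : glue m lam nu S = glue m lam nu S') : S = S' := by
  funext p
  have hp : (p : ℕ × ℕ) ∈ youngCells (m + 1) lam := by
    have := p.2
    rw [mem_youngCells] at this ⊢
    have := h2 _ this.1
    omega
  have := congrFun h ⟨p, hp⟩
  simpa [glue, p.2] using this

theorem schur_branch (m : ℕ) (lam : ℕ → ℕ) (hlam : ∀ i, i + 1 < m + 1 → lam (i + 1) ≤ lam i)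
    (x : Fin (m + 1) → ℂ) :
    schur (m + 1) lam x = ∑ mu ∈ Fintype.piFinset
        (fun j : Fin m => Finset.Icc (lam (j + 1)) (lam j)),
      x (Fin.last m) ^ (lam m + ∑ j : Fin m, (lam j - mu j)) *
        schur m (extz m mu) (fun i => x i.castSucc) := by
  classical
  unfold schur
  simp only [Finset.mul_sum]
  rw [Finset.sum_sigma']
  symm
  refine Finset.sum_bij (fun s _ => glue m lam (extz m s.1) s.2) ?_ ?_ ?_ ?_
  · rintro ⟨mu, S⟩ h
    simp only [Finset.mem_sigma, Fintype.mem_piFinset, Finset.mem_Icc, ssytFinset,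
      Finset.mem_filter, Finset.mem_univ, true_and] at h ⊢
    refine glue_ssyt ?_ h.2
    intro r hr
    rw [extz_lt _ hr]
    exact (h.1 ⟨r, hr⟩).1
  · rintro ⟨mu, S⟩ h ⟨mu', S'⟩ h' heq
    simp only [Finset.mem_sigma, Fintype.mem_piFinset, Finset.mem_Icc, ssytFinset,
      Finset.mem_filter, Finset.mem_univ, true_and] at h h' heq
    have key : ∀ (nu nu' : Fin m → ℕ) (R : {p // p ∈ youngCells m (extz m nu)} → Fin m)
        (R' : {p // p ∈ youngCells m (extz m nu')} → Fin m),
        (∀ j : Fin m, nu j ≤ lam j) →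
        glue m lam (extz m nu) R = glue m lam (extz m nu') R' → ∀ j, nu j ≤ nu' j := by
      intro nu nu' R R' hb hg j
      by_contra hlt
      push Not at hlt
      have c1 : ((j : ℕ), nu' j) ∈ youngCells (m + 1) lam := by
        rw [mem_youngCells]
        have := hb j
        have := j.2
        simp only
        omega
      have c2 := (glue_mem R ⟨_, c1⟩).1 (by
        rw [mem_youngCells]
        simp only [extz_apply]
        exact ⟨j.2, hlt⟩)
      rw [hg, ← glue_mem R' ⟨_, c1⟩, mem_youngCells] at c2
      simp [extz_apply] at c2
    have : mu = mu' := funext fun j => le_antisymm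
      (key mu mu' S S' (fun j => (h.1 j).2) heq j)
      (key mu' mu S' S (fun j => (h'.1 j).2) heq.symm j)
    subst this
    congr 1
    refine glue_inj ?_ heq
    intro r hr
    rw [extz_lt _ hr]
    exact (h.1 ⟨r, hr⟩).2
  · intro T hT
    simp only [ssytFinset, Finset.mem_filter, Finset.mem_univ, true_and] at hT
    obtain ⟨mu, h1, S, hS, hg⟩ := glue_surj hlam hT
    refine ⟨⟨mu, S⟩, ?_, hg⟩
    simp only [Finset.mem_sigma, Fintype.mem_piFinset, Finset.mem_Icc, ssytFinset,
      Finset.mem_filter, Finset.mem_univ, true_and]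
    exact ⟨h1, hS⟩
  · rintro ⟨mu, S⟩ h
    simp only [Finset.mem_sigma, Fintype.mem_piFinset, Finset.mem_Icc] at h
    rw [glue_prod]
    · congr 3
      rw [← Fin.sum_univ_eq_sum_range (fun r => lam r - extz m mu r)]
      simp only [extz_apply]
    · intro r hr
      rw [extz_lt _ hr]
      exact (h.1 ⟨r, hr⟩).2

/-- generalized Vandermonde determinant (alternant) -/
def alt {k : ℕ} (l : Fin k → ℕ) (x : Fin k → ℂ) : ℂ :=
  Matrix.det (Matrix.of fun j i => x i ^ l j)

/-- exponents of the alternant of a partition -/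
def shExp (k : ℕ) (lam : ℕ → ℕ) : Fin k → ℕ := fun j => lam j + (k - 1 - j)

lemma det_row_succ {n : ℕ} {A B : Matrix (Fin (n + 1)) (Fin (n + 1)) ℂ}
    (c : Fin n → ℂ) (hlast : ∀ i, A (Fin.last n) i = B (Fin.last n) i)
    (h : ∀ (j : Fin n) (i), A j.castSucc i = B j.castSucc i + c j * A j.succ i) :
    A.det = B.det := by
  rw [← Matrix.det_submatrix_equiv_self Fin.revPerm A,
    ← Matrix.det_submatrix_equiv_self Fin.revPerm B]
  refine Matrix.det_eq_of_forall_row_eq_smul_add_pred (fun j => c j.rev) ?_ ?_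
  · intro j
    simpa using hlast _
  · intro i j
    have := h i.rev j.rev
    simp only [Matrix.submatrix_apply, Fin.revPerm_apply, Fin.rev_succ, Fin.rev_castSucc]
    exact this

lemma geom_Icc (a y : ℂ) (u v e : ℕ) (huv : u ≤ v) :
    a ^ (v + (e + 1)) = (a - y) * ∑ p ∈ Finset.Icc u v, y ^ (v - p) * a ^ (p + e) +
      y ^ (v + 1 - u) * a ^ (u + e) := by
  induction v, huv using Nat.le_induction with
  | base => simp; ring
  | succ v huv ih =>
    rw [← Finset.insert_Icc_right_eq_Icc_add_one (by omega), Finset.sum_insert (by simp)]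
    have : ∑ p ∈ Finset.Icc u v, y ^ (v + 1 - p) * a ^ (p + e) =
        y * ∑ p ∈ Finset.Icc u v, y ^ (v - p) * a ^ (p + e) := by
      rw [Finset.mul_sum]
      refine Finset.sum_congr rfl fun p hp => ?_
      have := (Finset.mem_Icc.1 hp).2
      rw [show v + 1 - p = (v - p) + 1 by omega]
      ring
    rw [this, show v + 1 + 1 - u = (v + 1 - u) + 1 by omega, Nat.sub_self]
    have e1 : a ^ (v + 1 + (e + 1)) = (a - y) * a ^ (v + 1 + e) + y * a ^ (v + (e + 1)) := by ring
    rw [e1, ih]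
    ring

theorem alt_branch (m : ℕ) (lam : ℕ → ℕ) (hlam : ∀ i, i + 1 < m + 1 → lam (i + 1) ≤ lam i)
    (x : Fin (m + 1) → ℂ) :
    alt (shExp (m + 1) lam) x = (∏ i : Fin m, (x i.castSucc - x (Fin.last m))) *
      ∑ mu ∈ Fintype.piFinset (fun j : Fin m => Finset.Icc (lam (j + 1)) (lam j)),
      x (Fin.last m) ^ (lam m + ∑ j : Fin m, (lam j - mu j)) *
        alt (shExp m (extz m mu)) (fun i => x i.castSucc) := by
  classical
  set y := x (Fin.last m) with hy
  let N : Fin m → Fin (m + 1) → ℂ := fun j i =>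
    ∑ p ∈ Finset.Icc (lam (j + 1)) (lam j), y ^ (lam j - p) * x i ^ (p + (m - 1 - j))
  let B : Matrix (Fin (m + 1)) (Fin (m + 1)) ℂ := Matrix.of
    (Fin.snoc (α := fun _ => Fin (m + 1) → ℂ)
      (fun j i => (x i - y) * N j i) (fun i => x i ^ lam m))
  have hB : alt (shExp (m + 1) lam) x = B.det := by
    refine det_row_succ (fun j => y ^ (lam j + 1 - lam (j + 1))) ?_ ?_
    · intro i
      simp [B, shExp]
    · intro j i
      have hj := j.2
      have := geom_Icc (x i) y (lam (j + 1)) (lam j) (m - 1 - j) (hlam j (by omega))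
      simp only [B, shExp, Matrix.of_apply, Fin.snoc_castSucc, Fin.val_castSucc, Fin.val_succ, N]
      rw [show m + 1 - 1 - (j : ℕ) = m - 1 - j + 1 by omega,
        show m + 1 - 1 - ((j : ℕ) + 1) = m - 1 - j by omega]
      exact this
  rw [hB, Matrix.det_succ_column B (Fin.last m), Fin.sum_univ_castSucc]
  rw [Finset.sum_eq_zero]
  swap
  · intro j _
    simp [B, ← hy]
  have hs : (B.submatrix (Fin.last m).succAbove (Fin.last m).succAbove) =
      Matrix.of fun j i => (x i.castSucc - y) * (Matrix.of fun (j i : Fin m) => N j i.castSucc) j i := by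
    ext j i
    simp [B]
  have hN : Matrix.det (Matrix.of fun (j i : Fin m) => N j i.castSucc) =
      ∑ mu ∈ Fintype.piFinset (fun j : Fin m => Finset.Icc (lam (j + 1)) (lam j)),
        y ^ (∑ j : Fin m, (lam j - mu j)) *
        alt (shExp m (extz m mu)) (fun i => x i.castSucc) := by
    have h1 := MultilinearMap.map_sum_finset
      (Matrix.detRowAlternating (n := Fin m) (R := ℂ)).toMultilinearMap
      (fun (j : Fin m) (p : ℕ) => fun i : Fin m =>
        y ^ (lam j - p) * x i.castSucc ^ (p + (m - 1 - (j : ℕ))))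
      (fun j : Fin m => Finset.Icc (lam (j + 1)) (lam j))
    have h2 : (Matrix.of fun (j i : Fin m) => N j i.castSucc) = fun (j : Fin m) =>
        ∑ p ∈ Finset.Icc (lam (j + 1)) (lam j), fun i : Fin m =>
        y ^ (lam j - p) * x i.castSucc ^ (p + (m - 1 - (j : ℕ))) := by
      ext j i
      simp [N]
    rw [h2]
    refine h1.trans ?_
    refine Finset.sum_congr rfl fun mu _ => ?_
    have h3 := Matrix.det_mul_row (fun j : Fin m => y ^ (lam j - mu j))
      (Matrix.of fun (j i : Fin m) => x i.castSucc ^ (mu j + (m - 1 - (j : ℕ))))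
    have h4 := Matrix.det_mul_column (fun j : Fin m => y ^ (lam j - mu j))
      (Matrix.of fun (j i : Fin m) => x i.castSucc ^ (mu j + (m - 1 - (j : ℕ))))
    rw [← Finset.prod_pow_eq_pow_sum]
    unfold alt shExp
    simp only [extz_apply]
    exact h4
  rw [hs, Matrix.det_mul_row, hN]
  simp only [B, Matrix.of_apply, Fin.snoc_last, ← hy, zero_add, Fin.val_last, Finset.mul_sum]
  refine Finset.sum_congr rfl fun mu _ => ?_
  rw [Even.neg_one_pow ⟨m, rfl⟩, pow_add]
  ring

lemma alt_delta_succ (m : ℕ) (x : Fin (m + 1) → ℂ) :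
    alt (shExp (m + 1) fun _ => 0) x = (∏ i : Fin m, (x i.castSucc - x (Fin.last m))) *
      alt (shExp m fun _ => 0) (fun i => x i.castSucc) := by
  rw [alt_branch m _ (fun _ _ => le_rfl)]
  have : Fintype.piFinset (fun _ : Fin m => Finset.Icc 0 0) = {fun _ => 0} := by
    ext f
    simp [Fintype.mem_piFinset, funext_iff]
  rw [this, Finset.sum_singleton]
  have : extz m (fun _ => 0) = fun _ => 0 := by
    funext r
    simp [extz]
  simp [this]

lemma alt_delta_ne_zero (m : ℕ) (x : Fin m → ℂ) (hx : Function.Injective x) :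
    alt (shExp m fun _ => 0) x ≠ 0 := by
  induction m with
  | zero => simp [alt]
  | succ m ih =>
    rw [alt_delta_succ]
    refine mul_ne_zero (Finset.prod_ne_zero_iff.2 fun i _ => ?_)
      (ih _ fun a b h => Fin.castSucc_injective _ (hx h))
    rw [sub_ne_zero]
    exact fun h => Fin.castSucc_ne_last i (hx h)

theorem bialternant (m : ℕ) (lam : ℕ → ℕ) (hlam : ∀ i, i + 1 < m → lam (i + 1) ≤ lam i)
    (x : Fin m → ℂ) :
    schur m lam x * alt (shExp m fun _ => 0) x = alt (shExp m lam) x := by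
  classical
  induction m generalizing lam with
  | zero =>
    have : IsEmpty {p // p ∈ youngCells 0 lam} := ⟨fun p => by
      have := p.2
      rw [mem_youngCells] at this
      omega⟩
    have h2 : ssytFinset 0 lam = Finset.univ := by
      ext T
      simp only [ssytFinset, Finset.mem_filter, Finset.mem_univ, true_and, iff_true]
      exact ⟨fun p => isEmptyElim p, fun p => isEmptyElim p⟩
    simp [schur, alt, h2]
  | succ m ih =>
    rw [alt_branch m lam hlam, schur_branch m lam hlam, alt_delta_succ, Finset.sum_mul,
      Finset.mul_sum]
    refine Finset.sum_congr rfl fun mu hmu => ?_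
    rw [← ih (extz m mu)]
    · ring
    · intro i hi
      simp only [Fintype.mem_piFinset, Finset.mem_Icc] at hmu
      rw [extz_lt _ hi, extz_lt _ (by omega : i < m)]
      exact (hmu ⟨i + 1, hi⟩).2.trans (hmu ⟨i, by omega⟩).1

lemma pieri_alt {k : ℕ} (l : Fin k → ℕ) (x : Fin k → ℂ) :
    (∑ i, x i) * alt l x = ∑ j, alt (Function.update l j (l j + 1)) x := by
  classical
  simp only [alt, Matrix.det_apply', Matrix.of_apply]
  rw [Finset.sum_comm, Finset.mul_sum]
  refine Finset.sum_congr rfl fun s _ => ?_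
  rw [← Finset.mul_sum]
  have : ∀ i, ∏ t, x t ^ Function.update l (s i) (l (s i) + 1) (s t) =
      x i * ∏ t, x t ^ l (s t) := by
    intro i
    rw [← Finset.mul_prod_erase _ _ (Finset.mem_univ i),
      ← Finset.mul_prod_erase _ (fun t => x t ^ l (s t)) (Finset.mem_univ i)]
    rw [Function.update_self, pow_succ, Finset.prod_congr rfl
      (g := fun t => x t ^ l (s t))]
    · ring
    · intro t ht
      rw [Function.update_of_ne]
      exact fun h => (Finset.mem_erase.1 ht).1 (s.injective h)
  rw [← Equiv.sum_comp s (fun j => ∏ t, x t ^ Function.update l j (l j + 1) (s t))]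
  simp only [this]
  rw [← Finset.sum_mul]
  ring

lemma alt_zero_of_eq {k : ℕ} {l : Fin k → ℕ} (x : Fin k → ℂ) {a b : Fin k} (hab : a ≠ b)
    (h : l a = l b) : alt l x = 0 :=
  Matrix.det_zero_of_row_eq hab (by funext i; simp [h])

lemma alt_shift_zero {k : ℕ} (lam : ℕ → ℕ) (x : Fin k → ℂ) (j : ℕ) (hj : j + 1 < k)
    (h : lam j = lam (j + 1)) :
    alt (Function.update (shExp k lam) ⟨j + 1, hj⟩ (shExp k lam ⟨j + 1, hj⟩ + 1)) x = 0 := by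
  have hne : (⟨j, by omega⟩ : Fin k) ≠ ⟨j + 1, hj⟩ := by simp
  refine alt_zero_of_eq x hne ?_
  rw [Function.update_of_ne hne, Function.update_self]
  simp only [shExp]
  omega

lemma alt_update_pow {k n : ℕ} {c : ℂ} (l : Fin k → ℕ) (x : Fin k → ℂ) (hx : ∀ i, x i ^ n = c)
    (j : Fin k) : alt (Function.update l j n) x = c * alt (Function.update l j 0) x := by
  classical
  have h : ∀ p, (Matrix.of fun t i => x i ^ (Function.update l j p) t) =
      Matrix.updateRow (Matrix.of fun t i => x i ^ l t) j (fun i => x i ^ p) := by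
    intro p
    ext t i
    by_cases ht : t = j
    · subst ht; simp
    · simp [ht]
  unfold alt
  rw [h, h]
  have : (fun i => x i ^ n) = c • (fun i => x i ^ 0) := by
    funext i
    simp [hx]
  rw [this, Matrix.det_updateRow_smul]

lemma pieri_one {k : ℕ} (lam lam' : ℕ → ℕ) (x : Fin k → ℂ) (hx : Function.Injective x)
    (h1 : ∀ i, i + 1 < k → lam (i + 1) ≤ lam i) (h2 : ∀ i, i + 1 < k → lam' (i + 1) ≤ lam' i)
    (j0 : Fin k) (h0 : ∀ j : Fin k, lam' j = if j = j0 then lam j + 1 else lam j)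
    (hz : ∀ j : Fin k, j ≠ j0 →
      alt (Function.update (shExp k lam) j (shExp k lam j + 1)) x = 0) :
    schur k lam' x = (∑ i, x i) * schur k lam x := by
  refine mul_right_cancel₀ (alt_delta_ne_zero k x hx) ?_
  rw [bialternant k lam' h2, mul_assoc, bialternant k lam h1, pieri_alt,
    Finset.sum_eq_single j0 (fun j _ hj => hz j hj) (by simp)]
  congr 1
  funext j
  by_cases hj : j = j0
  · subst hj
    have := h0 j
    simp only [if_true] at this
    simp only [shExp, Function.update_self, this]
    omega
  · have := h0 j
    simp only [hj, if_false] at this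
    rw [Function.update_of_ne hj]
    simp only [shExp, this]

lemma schur_box {k : ℕ} (hk : 1 ≤ k) (x : Fin k → ℂ) (hx : Function.Injective x) :
    schur k (rectPart 1 1) x = ∑ i, x i := by
  have h := pieri_one (fun _ => 0) (rectPart 1 1) x hx (fun _ _ => le_rfl)
    (by intro i _; simp [rectPart]) ⟨0, hk⟩
    (by intro j; simp [rectPart, Fin.ext_iff])
    (by
      rintro ⟨j, hj⟩ hne
      obtain ⟨i, rfl⟩ : ∃ i, j = i + 1 := Nat.exists_eq_succ_of_ne_zero (by simpa using hne)
      exact alt_shift_zero _ x i hj rfl)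
  have h1 : schur k (fun _ => 0) x = 1 := by
    have := bialternant k (fun _ => 0) (fun _ _ => le_rfl) x
    exact mul_right_cancel₀ (alt_delta_ne_zero k x hx) (by rw [this, one_mul])
  rw [h, h1, mul_one]

lemma part_one {n k : ℕ} (hkn : k + 1 ≤ n) (x : Fin k → ℂ) (hx : Function.Injective x)
    (hxn : ∀ i, x i ^ n = (-1) ^ (k + 1)) (a : ℕ) (ha : 1 ≤ a) (hak : a + 1 ≤ k) :
    schur k (fun r => if r < a then n - k else if r = a then 1 else 0) x =
      (∑ i, x i) * schur k (rectPart a (n - k)) x := by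
  refine pieri_one _ _ x hx ?_ ?_ ⟨a, hak⟩ ?_ ?_
  · intro i _
    simp only [rectPart]
    split_ifs <;> omega
  · intro i _
    split_ifs <;> omega
  · intro j
    simp only [rectPart, Fin.ext_iff]
    split_ifs <;> omega
  · rintro ⟨j, hj⟩ hne
    simp only [ne_eq, Fin.mk.injEq] at hne
    rcases j with _ | i
    · have e : shExp k (rectPart a (n - k)) ⟨0, hj⟩ + 1 = n := by
        simp only [shExp, rectPart]
        rw [if_pos (by omega)]
        omega
      rw [e, alt_update_pow _ x hxn]
      have hl : (⟨k - 1, by omega⟩ : Fin k) ≠ ⟨0, hj⟩ := by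
        simp only [ne_eq, Fin.mk.injEq]; omega
      rw [alt_zero_of_eq x hl, mul_zero]
      rw [Function.update_of_ne hl, Function.update_self]
      simp only [shExp, rectPart]
      rw [if_neg (by omega)]
      omega
    · refine alt_shift_zero _ x i hj ?_
      simp only [rectPart]
      split_ifs <;> omega

lemma part_two {k : ℕ} (hk : 1 ≤ k) (x : Fin k → ℂ) (hx : Function.Injective x) (b : ℕ) :
    schur k (fun r => if r = 0 then b + 1 else if r < k then b else 0) x =
      (∑ i, x i) * schur k (rectPart k b) x := by
  refine pieri_one _ _ x hx ?_ ?_ ⟨0, hk⟩ ?_ ?_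
  · intro i _
    simp only [rectPart]
    split_ifs <;> omega
  · intro i hi
    have hi' : i < k := by omega
    simp only [hi, hi', if_true, Nat.succ_ne_zero, if_false]
    split_ifs <;> omega
  · intro j
    have := j.2
    simp only [rectPart, Fin.ext_iff]
    split_ifs <;> omega
  · rintro ⟨j, hj⟩ hne
    simp only [ne_eq, Fin.mk.injEq] at hne
    rcases j with _ | i
    · exact absurd rfl hne
    · refine alt_shift_zero _ x i hj ?_
      simp only [rectPart]
      split_ifs <;> omega

lemma part_three {n m : ℕ} (hkn : m + 2 ≤ n) (x : Fin (m + 1) → ℂ) (hx : Function.Injective x)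
    (hxn : ∀ i, x i ^ n = (-1) ^ (m + 1 + 1)) :
    schur (m + 1) (rectPart m (n - (m + 1) - 1)) x =
      (∑ i, x i) * schur (m + 1) (rectPart (m + 1) (n - (m + 1))) x := by
  refine mul_right_cancel₀ (alt_delta_ne_zero _ x hx) ?_
  rw [bialternant, mul_assoc, bialternant, pieri_alt, Finset.sum_eq_single 0]
  · have e : shExp (m + 1) (rectPart (m + 1) (n - (m + 1))) 0 + 1 = n := by
      simp [shExp, rectPart]
      omega
    rw [e, alt_update_pow _ x hxn]
    have hp := Matrix.det_permute (finRotate (m + 1)) (Matrix.of fun j i =>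
      x i ^ (Function.update (shExp (m + 1) (rectPart (m + 1) (n - (m + 1)))) 0 0) j)
    rw [sign_finRotate] at hp
    have hq : alt (shExp (m + 1) (rectPart m (n - (m + 1) - 1))) x =
        ((Matrix.of fun j i => x i ^ (Function.update
          (shExp (m + 1) (rectPart (m + 1) (n - (m + 1)))) 0 0) j).submatrix
            (finRotate (m + 1)) id).det := by
      unfold alt
      congr 1
      ext j i
      simp only [Matrix.of_apply, Matrix.submatrix_apply, id]
      congr 1
      induction j using Fin.lastCases with
      | last => simp [shExp, rectPart]
      | cast j =>
        have hj := j.2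
        rw [finRotate_apply, Fin.coeSucc_eq_succ, Function.update_of_ne (Fin.succ_ne_zero j)]
        simp only [shExp, rectPart, Fin.val_castSucc, Fin.val_succ]
        rw [if_pos hj, if_pos (by omega)]
        omega
    rw [hq, hp]
    simp only [alt, Nat.add_sub_cancel]
    push_cast
    ring
  · rintro ⟨j, hj⟩ _ hne
    rcases j with _ | i
    · exact absurd rfl hne
    · refine alt_shift_zero _ x i hj ?_
      simp only [rectPart]
      split_ifs <;> omega
  · simp
  · intro i _
    simp only [rectPart]
    split_ifs <;> omega
  · intro i _
    simp only [rectPart]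
    split_ifs <;> omega

/-- Quantum Pieri identities for Schur evaluations at root sets: multiplying a boundary
rectangular Schur evaluation by `S_{(1)}(I) = Σ_{ζ∈I} ζ` yields the Schur evaluation of
the quantum Pieri product diagram. -/
theorem quantum_pieri_boundary_rectangles
    (n k : ℕ) (hn : 2 ≤ n) (hk1 : 1 ≤ k) (hk2 : k ≤ n - 1)
    (I : Finset ℂ) (hI : IsRootSet k n I) :
    schurSet (rectPart 1 1) I = ∑ z ∈ I, z ∧
    (∀ a : ℕ, 1 ≤ a → a ≤ k - 1 →
      schurSet (fun r => if r < a then n - k else if r = a then 1 else 0) I =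
        schurSet (rectPart 1 1) I * schurSet (rectPart a (n - k)) I) ∧
    (∀ b : ℕ, 1 ≤ b → b ≤ n - k - 1 →
      schurSet (fun r => if r = 0 then b + 1 else if r < k then b else 0) I =
        schurSet (rectPart 1 1) I * schurSet (rectPart k b) I) ∧
    schurSet (rectPart (k - 1) (n - k - 1)) I =
      schurSet (rectPart 1 1) I * schurSet (rectPart k (n - k)) I := by
  obtain ⟨hc, hz⟩ := hI
  subst hc
  unfold schurSet
  have hx : Function.Injective fun i : Fin I.card => ((I.equivFin.symm i : I) : ℂ) :=
    fun a b h => I.equivFin.symm.injective (Subtype.ext h)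
  have hxn : ∀ i : Fin I.card, ((I.equivFin.symm i : I) : ℂ) ^ n = (-1) ^ (I.card + 1) :=
    fun i => hz _ (I.equivFin.symm i).2
  have hsum : ∑ i : Fin I.card, ((I.equivFin.symm i : I) : ℂ) = ∑ z ∈ I, z := by
    rw [Equiv.sum_comp I.equivFin.symm (fun z : I => (z : ℂ)), Finset.sum_coe_sort I (fun z => z)]
  have hbox := schur_box hk1 _ hx
  refine ⟨hbox.trans hsum, ?_, ?_, ?_⟩
  · intro a ha hak
    rw [hbox]
    exact part_one (by omega) _ hx hxn a ha (by omega)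
  · intro b _ _
    rw [hbox]
    exact part_two hk1 _ hx b
  · rw [hbox]
    have key : ∀ (k : ℕ) (x : Fin k → ℂ), 1 ≤ k → k ≤ n - 1 → Function.Injective x →
        (∀ i, x i ^ n = (-1) ^ (k + 1)) → schur k (rectPart (k - 1) (n - k - 1)) x =
          (∑ i, x i) * schur k (rectPart k (n - k)) x := by
      intro k x h1 h2 h3 h4
      obtain ⟨m, rfl⟩ : ∃ m, k = m + 1 := ⟨k - 1, by omega⟩
      exact part_three (by omega) x h3 h4
    exact key _ _ hk1 hk2 hx hxn

end
end

section
/- Let p be a prime, let u ∈ {1, −1} with u = −1 only allowed when p is odd, and let I be a set of m distinct complex numbers, 1 ≤ m ≤ p−1, each satisfying ζ^p = u. Then for all integers i, j with 1 ≤ j ≤ m and 1 ≤ i ≤ p−m, the Schur evaluation S_{(i^j)}(I) of the rectangular partition with j rows and i columns is nonzero. (This says that for n = p prime, every critical point of the Landau–Ginzburg superpotential of Gr(k,p) lies in the rectangular cluster chart.) -/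
noncomputable section

/-- Tableaux as functions on `ℕ × ℕ` vanishing outside the shape. -/
def IsTab (m : ℕ) (lam : ℕ → ℕ) (T : ℕ → ℕ → ℕ) : Prop :=
  (∀ r c, c < lam r → T r c < m) ∧ (∀ r c, lam r ≤ c → T r c = 0) ∧
  (∀ r c, c + 1 < lam r → T r c ≤ T r (c + 1)) ∧
  (∀ r c, c < lam (r + 1) → T r c < T (r + 1) c)

/-- Fill the cells of `lam` outside `mu` with `m`. -/
def extTab (m : ℕ) (lam mu : ℕ → ℕ) (T : ℕ → ℕ → ℕ) : ℕ → ℕ → ℕ :=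
  fun r c => if c < mu r then T r c else if c < lam r then m else 0

theorem isTab_extTab {m : ℕ} {lam mu : ℕ → ℕ} (h1 : ∀ r, mu r ≤ lam r)
    (h2 : ∀ r, lam (r + 1) ≤ mu r) {T : ℕ → ℕ → ℕ} (hT : IsTab m mu T) :
    IsTab (m + 1) lam (extTab m lam mu T) := by
  obtain ⟨a, b, c, d⟩ := hT
  refine ⟨?_, ?_, ?_, ?_⟩
  · intro r k hk
    have := a r k
    simp only [extTab]
    split_ifs <;> grind
  · intro r k hk
    have := h1 r
    simp only [extTab]
    split_ifs <;> grind
  · intro r k hk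
    have := a r k
    have := c r k
    simp only [extTab]
    split_ifs <;> grind
  · intro r k hk
    have := h1 r
    have := h2 r
    have := a r k
    have := d r k
    simp only [extTab]
    split_ifs <;> grind

theorem extTab_lt_iff {m : ℕ} {lam mu : ℕ → ℕ} (h1 : ∀ r, mu r ≤ lam r)
    {T : ℕ → ℕ → ℕ} (hT : IsTab m mu T) (r c : ℕ) :
    c < mu r ↔ (c < lam r ∧ extTab m lam mu T r c < m) := by
  have := hT.1 r c
  have := h1 r
  simp only [extTab]
  split_ifs <;> grind

theorem extTab_inj {m : ℕ} {lam mu mu' : ℕ → ℕ} (h1 : ∀ r, mu r ≤ lam r)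
    (h1' : ∀ r, mu' r ≤ lam r)
    {T T' : ℕ → ℕ → ℕ} (hT : IsTab m mu T) (hT' : IsTab m mu' T')
    (h : extTab m lam mu T = extTab m lam mu' T') : mu = mu' ∧ T = T' := by
  have hmu : mu = mu' := by
    funext r
    apply eq_of_forall_lt_iff
    intro c
    rw [extTab_lt_iff h1 hT, extTab_lt_iff h1' hT', h]
  refine ⟨hmu, ?_⟩
  subst hmu
  funext r c
  have h3 := congrFun (congrFun h r) c
  simp only [extTab] at h3
  have := hT.2.1 r c
  have := hT'.2.1 r c
  split_ifs at h3 <;> grind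

theorem exists_cut (f : ℕ → ℕ) (m : ℕ) : ∀ n : ℕ, (∀ c, c + 1 < n → f c ≤ f (c + 1)) →
    ∃ d, d ≤ n ∧ ∀ c, c < n → (f c < m ↔ c < d)
  | 0, _ => ⟨0, le_rfl, by simp⟩
  | n + 1, h => by
    obtain ⟨d, hd, hd'⟩ := exists_cut f m n (fun c hc => h c (by omega))
    by_cases hn : f n < m
    · refine ⟨n + 1, le_rfl, fun c hc => ?_⟩
      have key : ∀ k, k ≤ n → f (n - k) ≤ f n := by
        intro k
        induction k with
        | zero => intro _; simp
        | succ k ih =>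
          intro hk
          have := h (n - (k + 1)) (by omega)
          have e : n - (k + 1) + 1 = n - k := by omega
          rw [e] at this
          exact this.trans (ih (by omega))
      have := key (n - c) (by omega)
      have e : n - (n - c) = c := by omega
      rw [e] at this
      omega
    · refine ⟨d, by omega, fun c hc => ?_⟩
      rcases Nat.lt_succ_iff_lt_or_eq.1 hc with h' | h'
      · exact hd' c h'
      · subst h'; omega

theorem le_of_isTab {m : ℕ} {lam : ℕ → ℕ} (hl : Antitone lam) {T : ℕ → ℕ → ℕ}
    (hT : IsTab m lam T) : ∀ r c, c < lam r → r ≤ T r c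
  | 0, _, _ => Nat.zero_le _
  | r + 1, c, h => by
    have h1 := le_of_isTab hl hT r c (h.trans_le (hl (Nat.le_succ r)))
    have h2 := hT.2.2.2 r c h
    omega

theorem exists_extTab {m : ℕ} {lam : ℕ → ℕ} (hl : Antitone lam) {T : ℕ → ℕ → ℕ}
    (hT : IsTab (m + 1) lam T) : ∃ mu : ℕ → ℕ, (∀ r, mu r ≤ lam r) ∧
      (∀ r, lam (r + 1) ≤ mu r) ∧ (∀ r, m ≤ r → mu r = 0) ∧
      ∃ T', IsTab m mu T' ∧ extTab m lam mu T' = T := by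
  have hcut := fun r => exists_cut (T r) m (lam r) (fun c hc => hT.2.2.1 r c hc)
  choose mu hmu hmu' using hcut
  have h2 : ∀ r, lam (r + 1) ≤ mu r := by
    intro r
    by_contra! hlt
    have h3 := hT.2.2.2 r (mu r) hlt
    have h4 := hT.1 (r + 1) (mu r) hlt
    have h5 := hmu' r (mu r) (hlt.trans_le (hl (Nat.le_succ r)))
    omega
  refine ⟨mu, hmu, h2, ?_, fun r c => if c < mu r then T r c else 0, ⟨?_, ?_, ?_, ?_⟩, ?_⟩
  · intro r hr
    by_contra h0
    have h3 := hmu r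
    have h4 := hmu' r 0 (by omega)
    have h5 := le_of_isTab hl hT r 0 (by omega)
    omega
  · intro r c hc
    have := hmu r
    have := hmu' r c
    simp only [hc, if_true]
    grind
  · intro r c hc
    simp [hc]
  · intro r c hc
    have := hmu r
    have := hT.2.2.1 r c
    grind
  · intro r c hc
    have := hmu (r + 1)
    have := h2 r
    have := hT.2.2.2 r c
    grind
  · funext r c
    have := hmu r
    have := hmu' r c
    have := hT.1 r c
    have := hT.2.1 r c
    simp only [extTab]
    split_ifs <;> grind

/-- The shape with increasing row lengths `nu` read from bottom to top. -/
def shp {m : ℕ} (nu : Fin m → ℕ) : ℕ → ℕ :=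
  fun r => if h : r < m then nu ⟨m - 1 - r, by omega⟩ else 0

theorem shp_antitone {m : ℕ} {nu : Fin m → ℕ} (h : Monotone nu) : Antitone (shp nu) := by
  intro a b hab
  simp only [shp]
  split_ifs
  · apply h
    simp only [Fin.mk_le_mk]
    omega
  · omega
  · simp
  · simp

theorem shp_inj {m : ℕ} {nu nu' : Fin m → ℕ} (h : shp nu = shp nu') : nu = nu' := by
  funext i
  have h1 := congrFun h (m - 1 - i)
  have hi := i.2
  have e : m - 1 - (m - 1 - (i : ℕ)) = i := by omega
  have h2 : m - 1 - (i : ℕ) < m := by omega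
  simpa [shp, h2, e] using h1

theorem sum_choose_Icc (a b i j : ℕ) (h : a ≤ b) :
    ∑ x ∈ Finset.Icc a b, ((x + i).choose j : ℤ) =
      ((b + (i + 1)).choose (j + 1) : ℤ) - ((a + i).choose (j + 1) : ℤ) := by
  induction b, h using Nat.le_induction with
  | base =>
    simp only [Finset.Icc_self, Finset.sum_singleton, ← add_assoc, Nat.choose_succ_succ]
    push_cast
    ring
  | succ b hb ih =>
    rw [← Finset.insert_Icc_right_eq_Icc_add_one (by omega), Finset.sum_insert (by simp), ih]
    rw [show b + 1 + (i + 1) = (b + 1 + i) + 1 by ring, Nat.choose_succ_succ]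
    rw [show b + (i + 1) = b + 1 + i by ring]
    push_cast
    ring

theorem det_step {m : ℕ} (nu : Fin (m + 1) → ℕ) (h : Monotone nu) :
    (Matrix.of fun i j : Fin (m + 1) => ((nu i + i).choose j : ℤ)).det =
    ∑ mu ∈ Fintype.piFinset (fun i : Fin m => Finset.Icc (nu i.castSucc) (nu i.succ)),
      (Matrix.of fun i j : Fin m => ((mu i + i).choose j : ℤ)).det := by
  have h1 := (Matrix.detRowAlternating (R := ℤ) (n := Fin m)).toMultilinearMap.map_sum_finset
    (fun (i : Fin m) (x : ℕ) => fun j : Fin m => ((x + i).choose j : ℤ))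
    (fun i : Fin m => Finset.Icc (nu i.castSucc) (nu i.succ))
  have h2 : (Matrix.of fun i j : Fin m =>
      (((nu i.succ + (i + 1)).choose (j + 1) : ℤ) - ((nu i.castSucc + i).choose (j + 1) : ℤ))).det
      = ∑ mu ∈ Fintype.piFinset (fun i : Fin m => Finset.Icc (nu i.castSucc) (nu i.succ)),
      (Matrix.of fun i j : Fin m => ((mu i + i).choose j : ℤ)).det := by
    refine Eq.trans ?_ h1
    change Matrix.det _ = Matrix.det _
    congr 1
    ext i j
    simp only [Matrix.of_apply]
    rw [Finset.sum_apply]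
    exact (sum_choose_Icc _ _ _ _ (h (Fin.castSucc_lt_succ).le)).symm
  rw [← h2]
  rw [Matrix.det_eq_of_forall_row_eq_smul_add_pred (B := Matrix.of (Fin.cons
    (fun j : Fin (m + 1) => ((nu 0).choose j : ℤ))
    (fun (i : Fin m) (j : Fin (m + 1)) => ((nu i.succ + (i + 1)).choose j : ℤ) -
      ((nu i.castSucc + i).choose j : ℤ)))) (fun _ => 1)]
  · rw [Matrix.det_succ_column_zero, Fin.sum_univ_succ]
    simp
    rfl
  · intro j
    simp
  · intro i j
    simp

theorem exists_count : ∀ (m : ℕ) (nu : Fin m → ℕ), Monotone nu →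
    ∃ F : Finset (ℕ → ℕ → ℕ), (∀ T, T ∈ F ↔ IsTab m (shp nu) T) ∧
      (F.card : ℤ) = (Matrix.of fun i j : Fin m => ((nu i + i).choose j : ℤ)).det
  | 0, nu, _ => by
    refine ⟨{fun _ _ => 0}, ?_, by simp⟩
    intro T
    rw [Finset.mem_singleton]
    constructor
    · rintro rfl
      simp [IsTab, shp]
    · intro h
      funext r c
      exact h.2.1 r c (by simp [shp])
  | m + 1, nu, hnu => by
    classical
    have hmono : ∀ mu ∈ Fintype.piFinset
        (fun i : Fin m => Finset.Icc (nu i.castSucc) (nu i.succ)), Monotone mu := by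
      intro mu hmu
      simp only [Fintype.mem_piFinset, Finset.mem_Icc] at hmu
      intro a b hab
      rcases hab.eq_or_lt with rfl | hab
      · exact le_rfl
      · refine (hmu a).2.trans (le_trans (hnu ?_) (hmu b).1)
        rw [Fin.le_def]
        simpa using hab
    have hle : ∀ mu ∈ Fintype.piFinset
        (fun i : Fin m => Finset.Icc (nu i.castSucc) (nu i.succ)), ∀ r, shp mu r ≤ shp nu r := by
      intro mu hmu r
      simp only [Fintype.mem_piFinset, Finset.mem_Icc] at hmu
      simp only [shp]
      split_ifs with h1 h2
      · refine (hmu _).2.trans (le_of_eq ?_)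
        congr 1
        ext
        simp
        omega
      · omega
      · simp
      · simp
    have hge : ∀ mu ∈ Fintype.piFinset
        (fun i : Fin m => Finset.Icc (nu i.castSucc) (nu i.succ)),
        ∀ r, shp nu (r + 1) ≤ shp mu r := by
      intro mu hmu r
      simp only [Fintype.mem_piFinset, Finset.mem_Icc] at hmu
      simp only [shp]
      split_ifs with h1 h2
      · refine le_trans (le_of_eq ?_) (hmu _).1
        congr 1
        ext
        simp
        omega
      · omega
      · simp
      · simp
    have ih : ∀ mu : Fin m → ℕ, ∃ F : Finset (ℕ → ℕ → ℕ), Monotone mu →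
      ((∀ T, T ∈ F ↔ IsTab m (shp mu) T) ∧
      (F.card : ℤ) = (Matrix.of fun i j : Fin m => ((mu i + i).choose j : ℤ)).det) := by
      intro mu
      by_cases h : Monotone mu
      · obtain ⟨F, hF⟩ := exists_count m mu h
        exact ⟨F, fun _ => hF⟩
      · exact ⟨∅, fun h' => absurd h' h⟩
    choose F hF using ih
    refine ⟨(Fintype.piFinset (fun i : Fin m => Finset.Icc (nu i.castSucc) (nu i.succ))).biUnion
      (fun mu => (F mu).image (extTab m (shp nu) (shp mu))), ?_, ?_⟩
    · intro T
      simp only [Finset.mem_biUnion, Finset.mem_image]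
      constructor
      · rintro ⟨mu, hmu, T', hT', rfl⟩
        exact isTab_extTab (hle mu hmu) (hge mu hmu) (((hF mu (hmono mu hmu)).1 T').1 hT')
      · intro hT
        obtain ⟨mu, h1, h2, h3, T', hT', rfl⟩ := exists_extTab (shp_antitone hnu) hT
        have e : shp (fun i : Fin m => mu (m - 1 - i)) = mu := by
          funext r
          simp only [shp]
          split_ifs with hr
          · congr 1
            omega
          · exact (h3 r (by omega)).symm
        have hmem : (fun i : Fin m => mu (m - 1 - i)) ∈ Fintype.piFinset
            (fun i : Fin m => Finset.Icc (nu i.castSucc) (nu i.succ)) := by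
          simp only [Fintype.mem_piFinset, Finset.mem_Icc]
          intro i
          have hi := i.2
          constructor
          · refine le_trans (le_of_eq ?_) (h2 _)
            simp only [shp]
            rw [dif_pos (by omega)]
            congr 1
            ext
            simp
            omega
          · refine le_trans (h1 _) (le_of_eq ?_)
            simp only [shp]
            rw [dif_pos (by omega)]
            congr 1
            ext
            simp
            omega
        refine ⟨_, hmem, T', ?_, by rw [e]⟩
        rw [(hF _ (hmono _ hmem)).1, e]
        exact hT'
    · rw [det_step nu hnu, Finset.card_biUnion]
      · push_cast
        refine Finset.sum_congr rfl fun mu hmu => ?_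
        rw [← (hF mu (hmono mu hmu)).2, Finset.card_image_of_injOn]
        intro T hT T' hT' heq
        exact (extTab_inj (hle mu hmu) (hle mu hmu) (((hF mu (hmono mu hmu)).1 T).1 hT)
          (((hF mu (hmono mu hmu)).1 T').1 hT') heq).2
      · intro mu hmu mu' hmu' hne
        rw [Function.onFun, Finset.disjoint_left]
        intro X hX hX'
        obtain ⟨T, hT, rfl⟩ := Finset.mem_image.1 hX
        obtain ⟨T', hT', heq⟩ := Finset.mem_image.1 hX'
        exact hne (shp_inj (extTab_inj (hle mu hmu) (hle mu' hmu')
          (((hF mu (hmono mu hmu)).1 T).1 hT)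
          (((hF mu' (hmono mu' hmu')).1 T').1 hT') heq.symm).1)

theorem det_choose_not_dvd {p m : ℕ} (hp : p.Prime) (b : Fin m → ℕ)
    (hb : Function.Injective b) (hlt : ∀ i, b i < p) :
    ¬ (p : ℤ) ∣ (Matrix.of fun i j : Fin m => ((b i).choose j : ℤ)).det := by
  have : Fact p.Prime := ⟨hp⟩
  rw [← CharP.intCast_eq_zero_iff (ZMod p) p]
  intro h0
  have h1 := Matrix.det_eval_matrixOfPolynomials_eq_det_vandermonde
      (fun i => (b i : ZMod p))
      (fun i => descPochhammer (ZMod p) i)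
      (fun i => descPochhammer_natDegree (ZMod p) i)
      (fun i => monic_descPochhammer (ZMod p) i)
  have h2 : (Matrix.of fun i j : Fin m => (descPochhammer (ZMod p) j).eval (b i : ZMod p)) =
      Matrix.of fun i j : Fin m => ((j : ℕ).factorial : ZMod p) *
        (Matrix.of fun i j : Fin m => ((b i).choose j : ZMod p)) i j := by
    ext i j
    simp only [Matrix.of_apply]
    rw [descPochhammer_eval_eq_descFactorial, Nat.descFactorial_eq_factorial_mul_choose]
    push_cast
    rfl
  rw [h2, Matrix.det_mul_row] at h1
  have h3 : (Matrix.of fun i j : Fin m => ((b i).choose j : ZMod p)).det = 0 := by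
    rw [← h0]
    have := (Int.castRingHom (ZMod p)).map_det
      (Matrix.of fun i j : Fin m => ((b i).choose j : ℤ))
    rw [eq_intCast] at this
    rw [this]
    congr 1
    ext i j
    simp
  rw [h3, mul_zero] at h1
  refine (Matrix.det_vandermonde_ne_zero_iff (v := fun i => (b i : ZMod p))).2 ?_ h1
  intro i j hij
  apply hb
  have := (ZMod.natCast_eq_natCast_iff' _ _ _).1 hij
  rwa [Nat.mod_eq_of_lt (hlt i), Nat.mod_eq_of_lt (hlt j)] at this

theorem card_ssyt_not_dvd {p m i j : ℕ} (hp : p.Prime) (hj : j ≤ m) (hi : i + m ≤ p) :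
    ¬ p ∣ (ssytFinset m (rectPart j i)).card := by
  classical
  let nu : Fin m → ℕ := fun k => rectPart j i (m - 1 - k)
  have hnu : Monotone nu := by
    intro a b hab
    have : (a : ℕ) ≤ b := hab
    simp only [nu, rectPart]
    split_ifs <;> omega
  have hs : shp nu = rectPart j i := by
    funext r
    simp only [shp, nu]
    split_ifs with h
    · congr 1
      omega
    · simp only [rectPart]
      rw [if_neg (by omega)]
  obtain ⟨F, hF, hcard⟩ := exists_count m nu hnu
  rw [hs] at hF
  have hcell : ∀ r c, (r, c) ∈ youngCells m (rectPart j i) ↔ c < rectPart j i r := by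
    intro r c
    simp only [youngCells, Finset.mem_biUnion, Finset.mem_image, Finset.mem_range, Prod.mk.injEq]
    constructor
    · rintro ⟨a, _, b, hb, rfl, rfl⟩
      exact hb
    · intro h
      refine ⟨r, ?_, c, h, rfl, rfl⟩
      by_contra hr
      simp only [rectPart] at h
      rw [if_neg (by omega)] at h
      omega
  have hanti : Antitone (rectPart j i) := hs ▸ shp_antitone hnu
  have key : (ssytFinset m (rectPart j i)).card = F.card := by
    refine Finset.card_bij' (fun T _ => fun r c =>
        if h : (r, c) ∈ youngCells m (rectPart j i) then (T ⟨(r, c), h⟩ : ℕ) else 0)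
      (fun T hT => fun q => ⟨T q.1.1 q.1.2, ((hF T).1 hT).1 _ _ ((hcell _ _).1 q.2)⟩) ?_ ?_ ?_ ?_
    · intro T hT
      rw [hF]
      simp only [ssytFinset, Finset.mem_filter, Finset.mem_univ, true_and] at hT
      obtain ⟨hr, hc⟩ := hT
      refine ⟨?_, ?_, ?_, ?_⟩
      · intro r c h
        beta_reduce
        rw [dif_pos ((hcell _ _).2 h)]
        exact Fin.is_lt _
      · intro r c h
        beta_reduce
        rw [dif_neg (by rw [hcell]; omega)]
      · intro r c h
        beta_reduce
        rw [dif_pos ((hcell _ _).2 h), dif_pos ((hcell _ _).2 (by omega))]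
        exact hr _ _ rfl rfl
      · intro r c h
        beta_reduce
        rw [dif_pos ((hcell _ _).2 h), dif_pos ((hcell _ _).2 (h.trans_le (hanti (Nat.le_succ r))))]
        exact hc _ _ rfl rfl
    · intro T hT
      simp only [ssytFinset, Finset.mem_filter, Finset.mem_univ, true_and]
      have hT' := (hF T).1 hT
      constructor
      · rintro ⟨⟨a, b⟩, hab⟩ ⟨⟨c, d⟩, hcd⟩ h1 h2
        simp only at h1 h2
        subst h1 h2
        exact hT'.2.2.1 _ _ ((hcell _ _).1 hcd)
      · rintro ⟨⟨a, b⟩, hab⟩ ⟨⟨c, d⟩, hcd⟩ h1 h2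
        simp only at h1 h2
        subst h1 h2
        exact hT'.2.2.2 _ _ ((hcell _ _).1 hcd)
    · intro T hT
      funext q
      ext
      simp
    · intro T hT
      funext r c
      have hT' := (hF T).1 hT
      by_cases h : (r, c) ∈ youngCells m (rectPart j i)
      · simp [h]
      · simp only [h, dif_neg, not_false_eq_true]
        rw [hcell, not_lt] at h
        exact (hT'.2.1 _ _ h).symm
  rw [key, ← Int.natCast_dvd_natCast, hcard]
  apply det_choose_not_dvd hp (fun k => nu k + k)
  · apply StrictMono.injective
    intro a b hab
    have := hnu hab.le
    have : (a : ℕ) < b := hab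
    simp only
    omega
  · intro k
    have := k.2
    simp only [nu, rectPart]
    split_ifs <;> omega

theorem exists_reduction (p : ℕ) (hp : p.Prime) :
    ∃ M : Ideal (integralClosure ℤ ℂ), M.IsMaximal ∧ (p : integralClosure ℤ ℂ) ∈ M := by
  have hnu : ¬ IsUnit (p : integralClosure ℤ ℂ) := by
    intro h
    obtain ⟨a, ha⟩ := h.exists_right_inv
    have ha' : (p : ℂ) * (a : ℂ) = 1 := by
      have := congrArg (fun x : integralClosure ℤ ℂ => (x : ℂ)) ha
      simpa using this
    have hint : IsIntegral ℤ (a : ℂ) := a.2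
    have hp0 : (p : ℂ) ≠ 0 := by exact_mod_cast hp.ne_zero
    have hq : (a : ℂ) = algebraMap ℚ ℂ ((p : ℚ)⁻¹) := by
      simp only [map_inv₀, map_natCast]
      exact eq_inv_of_mul_eq_one_right ha'
    rw [hq, isIntegral_algebraMap_iff (algebraMap ℚ ℂ).injective] at hint
    obtain ⟨n, hn⟩ := IsIntegrallyClosed.isIntegral_iff.1 hint
    have hp0' : (p : ℚ) ≠ 0 := by exact_mod_cast hp.ne_zero
    have h1 : (p : ℚ) * n = 1 := by
      have : (n : ℚ) = (p : ℚ)⁻¹ := by simpa using hn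
      rw [this, mul_inv_cancel₀ hp0']
    have h2 : (p : ℤ) * n = 1 := by exact_mod_cast h1
    have h3 : (p : ℤ) ∣ 1 := ⟨n, h2.symm⟩
    have h4 : p ∣ 1 := by exact_mod_cast h3
    exact hp.one_lt.ne' (Nat.dvd_one.1 h4)
  obtain ⟨M, hM, hpM⟩ := exists_max_ideal_of_mem_nonunits hnu
  exact ⟨M, hM, hpM⟩

theorem schur_ne_zero_of_count {p m : ℕ} (hp : p.Prime) (u : ℂ)
    (hu : u = 1 ∨ (u = -1 ∧ Odd p)) (lam : ℕ → ℕ) (x : Fin m → ℂ) (hx : ∀ k, x k ^ p = u)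
    (hc : ¬ p ∣ (ssytFinset m lam).card) : schur m lam x ≠ 0 := by
  intro h0
  obtain ⟨M, hM, hpM⟩ := exists_reduction p hp
  have hui : IsIntegral ℤ u := by
    rcases hu with rfl | ⟨rfl, _⟩
    · exact isIntegral_one
    · exact isIntegral_one.neg
  have hup : u ^ p = u := by
    rcases hu with rfl | ⟨rfl, h⟩
    · simp
    · exact h.neg_one_pow
  have hu0 : u * u = 1 := by
    rcases hu with rfl | ⟨rfl, h⟩ <;> simp
  have hxi : ∀ k, IsIntegral ℤ (x k) := fun k =>
    IsIntegral.of_pow hp.pos (by rw [hx k]; exact hui)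
  let U : integralClosure ℤ ℂ := ⟨u, hui⟩
  let X : Fin m → integralClosure ℤ ℂ := fun k => ⟨x k, hxi k⟩
  let _ : Field (integralClosure ℤ ℂ ⧸ M) := Ideal.Quotient.field M
  have hp0 : ((p : ℕ) : integralClosure ℤ ℂ ⧸ M) = 0 := by
    have := Ideal.Quotient.eq_zero_iff_mem.2 hpM
    simpa using this
  have : Fact p.Prime := ⟨hp⟩
  have : CharP (integralClosure ℤ ℂ ⧸ M) p := by
    obtain ⟨q, hq⟩ := CharP.exists (integralClosure ℤ ℂ ⧸ M)
    have h1 := (CharP.cast_eq_zero_iff (integralClosure ℤ ℂ ⧸ M) q p).1 hp0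
    rcases (Nat.dvd_prime hp).1 h1 with h | h
    · subst h
      exact absurd rfl (CharP.char_ne_one (integralClosure ℤ ℂ ⧸ M) 1)
    · subst h
      exact hq
  let φ := Ideal.Quotient.mk M
  have hX : ∀ k, φ (X k) = φ U := by
    intro k
    have h1 : X k ^ p = U ^ p := by
      ext
      simp [X, U, hx k, hup]
    have h2 : (φ (X k) - φ U) ^ p = 0 := by
      rw [sub_pow_char, ← map_pow, ← map_pow, h1, sub_self]
    exact sub_eq_zero.1 (pow_eq_zero_iff hp.ne_zero |>.1 h2)
  have hS : ∑ T ∈ ssytFinset m lam, ∏ q, X (T q) = 0 := by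
    ext
    push_cast
    exact h0
  have h1 := congrArg φ hS
  rw [map_sum, map_zero] at h1
  simp only [map_prod, hX, Finset.prod_const, Finset.sum_const, nsmul_eq_mul] at h1
  rcases mul_eq_zero.1 h1 with h2 | h2
  · exact hc ((CharP.cast_eq_zero_iff (integralClosure ℤ ℂ ⧸ M) p _).1 h2)
  · have h3 : φ U = 0 := eq_zero_of_pow_eq_zero h2
    have h4 : U * U = 1 := by
      ext
      simpa [U] using hu0
    have h5 := congrArg φ h4
    rw [map_mul, h3, map_one, mul_zero] at h5
    exact zero_ne_one h5

/-- For `n = p` prime, every rectangular Schur evaluation at a set of `m` distinct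
`p`-th roots of `u` (with `u = ±1`, `u = −1` only for `p` odd) is nonzero: every
critical point of the Landau–Ginzburg superpotential of `Gr(k,p)` lies in the
rectangular cluster chart. -/
theorem rect_schur_ne_zero_of_prime
    (p m : ℕ) (hp : Nat.Prime p) (u : ℂ) (hu : u = 1 ∨ (u = -1 ∧ Odd p))
    (I : Finset ℂ) (hm1 : 1 ≤ m) (hm2 : m ≤ p - 1) (hcard : I.card = m)
    (hroot : ∀ z ∈ I, z ^ p = u) :
    ∀ i j : ℕ, 1 ≤ j → j ≤ m → 1 ≤ i → i ≤ p - m →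
      schurSet (rectPart j i) I ≠ 0 := by
  intro i j hj1 hj hi1 hi
  subst hcard
  have := hp.two_le
  exact schur_ne_zero_of_count hp u hu _ _ (fun k => hroot _ (I.equivFin.symm k).2)
    (card_ssyt_not_dvd hp hj (by omega))

end
end
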